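/- arXiv:2605.16261 — 4 statements merged into one kernel-verified Lean document; each statement's English description precedes it below -/
import Mathlib

section
/- There exists a constant c such that for every integer t and all strings (or tuples) y, z with |y| < 2^t/2 − c and |z| < 2^t/2 − c: |T_t(y)| ≥ |T_t(z)| · 2^{−cδ − c}, where δ = C_V(y | z), T_t(y) = {s : C_V(y, s) ≤ 2^t}, and T_t(z) = {s : C_V(z, s) ≤ 2^t}. -/
open scoped Classical ENNReal

/-- Binary strings. -/
abbrev BStr := List Bool

/-- Plain Kolmogorov complexity of `x` with respect to a decompressor `D`
(a partial function from binary strings to binary strings):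
the minimal length of a description `p` with `D p = x`. -/
noncomputable def plainC (D : BStr →. BStr) (x : BStr) : ℕ :=
  sInf {n | ∃ p : BStr, p.length = n ∧ x ∈ D p}

/-- Conditional complexity of `x` given `y` with respect to a two-argument
decompressor `D` (first argument: program, second: condition). -/
noncomputable def condC (D : BStr → BStr →. BStr) (x y : BStr) : ℕ :=
  sInf {n | ∃ p : BStr, p.length = n ∧ x ∈ D p y}

/-- A fixed computable encoding of natural numbers as binary strings. -/
def natStr (n : ℕ) : BStr := Nat.bits n

/-- A fixed computable pairing function on binary strings. -/
def pairStr (x y : BStr) : BStr := natStr (Encodable.encode (x, y))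

/-- A fixed computable encoding of triples of binary strings. -/
def tripStr (x y z : BStr) : BStr := natStr (Encodable.encode (x, y, z))

/-- An optimal (universal) plain decompressor `V`: a partial computable
decompressor whose complexity function is minimal up to an additive constant
among all partial computable decompressors. -/
structure OptimalDecompressor where
  V : BStr →. BStr
  partrec : Partrec V
  onto : ∀ x : BStr, ∃ p : BStr, x ∈ V p
  optimal : ∀ D : BStr →. BStr, Partrec D → ∃ M : ℕ, ∀ x : BStr,
    (∃ p : BStr, x ∈ D p) → plainC V x ≤ plainC D x + M

/-- A universal two-argument decompressor for conditional plain complexity. -/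
structure CondOptimalDecompressor where
  Vc : BStr → BStr →. BStr
  partrec : Partrec₂ Vc
  onto : ∀ x y : BStr, ∃ p : BStr, x ∈ Vc p y
  optimal : ∀ D : BStr → BStr →. BStr, Partrec₂ D → ∃ M : ℕ, ∀ x y : BStr,
    (∃ p : BStr, x ∈ D p y) → condC Vc x y ≤ condC D x y + M

/-- A two-argument decompressor is prefix-free if for each condition `y`
its domain (in the program argument) is prefix-free. -/
def PrefixFreeDom (D : BStr → BStr →. BStr) : Prop :=
  ∀ y p q : BStr, (D p y).Dom → (D q y).Dom → p <+: q → p = q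

/-- A universal prefix-free conditional decompressor, defining conditional
prefix complexity `K(x | y)`. -/
structure UniversalPrefixDecompressor where
  D : BStr → BStr →. BStr
  partrec : Partrec₂ D
  prefixFree : PrefixFreeDom D
  onto : ∀ x y : BStr, ∃ p : BStr, x ∈ D p y
  universal : ∀ D' : BStr → BStr →. BStr, Partrec₂ D' → PrefixFreeDom D' →
    ∃ c : ℕ, ∀ x y : BStr, (∃ p : BStr, x ∈ D' p y) →
      condC D x y ≤ condC D' x y + c

/-- Conditional prefix complexity `K(x | y)` with respect to a universal
prefix-free conditional decompressor `U`. -/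
noncomputable def K (U : UniversalPrefixDecompressor) (x y : BStr) : ℕ := condC U.D x y

/-- The canonical enumeration of all pairs `(x, k)` with `C_V(x) ≤ k`,
obtained by dovetailing the computations of `V` on all programs: a computable
listing whose range is exactly the set of such pairs. -/
structure CanonicalEnum (V : BStr →. BStr) where
  e : ℕ → Option (BStr × ℕ)
  computable : Computable e
  mem_iff : ∀ x : BStr, ∀ k : ℕ, (∃ t, e t = some (x, k)) ↔ plainC V x ≤ k

/-- The moment of first appearance of string `x` in the canonical enumeration
as a pair `(x, k)` with `k ≤ n`. -/
noncomputable def strFirst {V : BStr →. BStr} (E : CanonicalEnum V) (x : BStr) (n : ℕ) : ℕ :=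
  sInf {t | ∃ k ≤ n, E.e t = some (x, k)}

/-- `w` is the last string of complexity at most `n` (i.e. `w = w_n`):
it has `C_V(w) ≤ n` and every string of complexity at most `n` appears
(as a pair with bound `≤ n`) no later than `w` does. -/
def IsLastSimple (O : OptimalDecompressor) (E : CanonicalEnum O.V) (n : ℕ) (w : BStr) : Prop :=
  plainC O.V w ≤ n ∧ ∀ x : BStr, plainC O.V x ≤ n → strFirst E x n ≤ strFirst E w n

/-- The extension set `T_t(y) = { s : C_V(y, s) ≤ 2^t }`. -/
def Tset (O : OptimalDecompressor) (t : ℕ) (y : BStr) : Set BStr :=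
  {s | plainC O.V (pairStr y s) ≤ 2 ^ t}

/-- The relaxed extension set `T_t^δ(y) = { s : C_V(y, s) ≤ 2^t + δ }`. -/
def TsetR (O : OptimalDecompressor) (t δ : ℕ) (y : BStr) : Set BStr :=
  {s | plainC O.V (pairStr y s) ≤ 2 ^ t + δ}

/-- The "past" set `St^w_t(y)`: extensions `s` with `C_V(y, s) ≤ 2^t` whose
pair appears in the canonical enumeration (with bound `≤ 2^t`) strictly
before `w = w_n` appears (with bound `≤ n`). -/
def StSet (O : OptimalDecompressor) (E : CanonicalEnum O.V) (t n : ℕ) (w : BStr)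
    (y : BStr) : Set BStr :=
  {s | plainC O.V (pairStr y s) ≤ 2 ^ t ∧
       strFirst E (pairStr y s) (2 ^ t) < strFirst E w n}

/-- The tower sequence `a_0 = 1`, `a_{i+1} = 2^{a_i}`. -/
def tower : ℕ → ℕ
  | 0 => 1
  | i + 1 => 2 ^ tower i

/-- `qt` is a structural witness for `q` relative to `n` with constant `c₀`:
it is short, effectively encodes `q`, and satisfies the complexity
decomposition `K(q̃ | n) = K(q̃, α, K(q̃, α | q) | n) + O(1)` where `α = K(q̃ | n)`. -/
def StructuralWitness (Oc : CondOptimalDecompressor) (U : UniversalPrefixDecompressor)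
    (c₀ n q : ℕ) (qt : BStr) : Prop :=
  qt.length ≤ c₀ * Nat.log 2 q ∧
  condC Oc.Vc (natStr q) qt ≤ c₀ ∧
  K U qt (natStr n) ≤
      K U (tripStr qt (natStr (K U qt (natStr n)))
        (natStr (K U (pairStr qt (natStr (K U qt (natStr n)))) (natStr q)))) (natStr n) + c₀ ∧
  K U (tripStr qt (natStr (K U qt (natStr n)))
        (natStr (K U (pairStr qt (natStr (K U qt (natStr n)))) (natStr q)))) (natStr n) ≤
      K U qt (natStr n) + c₀


open Nat.Partrec (Code)

theorem cs_primrec_bits : Primrec Nat.bits := by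
  have h : Primrec₂ (fun (_ : Unit) (n : ℕ) => Nat.bits n) := by
    refine Primrec.nat_strong_rec _
      (g := fun _ l => if l.length = 0 then some [] else
        (l[l.length / 2]?).map (fun t => Nat.bodd l.length :: t)) ?_ ?_
    · have hl : Primrec (fun x : Unit × List (List Bool) => x.2.length) :=
        Primrec.list_length.comp Primrec.snd
      refine Primrec.ite (Primrec.eq.comp hl (Primrec.const 0)) (Primrec.const _) ?_
      refine Primrec.option_map (Primrec.list_getElem?.comp Primrec.snd
        (Primrec.nat_div.comp hl (Primrec.const 2))) ?_
      exact Primrec.list_cons.comp (Primrec.nat_bodd.comp (hl.comp Primrec.fst)) Primrec.snd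
    · intro _ n
      rcases Nat.eq_zero_or_pos n with rfl | hn
      · simp
      · have h2 : n / 2 < n := by omega
        have h3 : Nat.bits n = Nat.bodd n :: Nat.bits (n / 2) := by
          rw [← Nat.div2_val]
          conv_lhs => rw [← Nat.bit_bodd_div2 n]
          apply Nat.bits_append_bit
          intro h0
          have := Nat.bodd_add_div2 n
          rw [h0] at this
          cases hb : n.bodd <;> simp_all
        simp [hn.ne', h2, h3]
  exact h.comp (Primrec.const ()) Primrec.id

theorem cs_primrec_pairStr : Primrec₂ pairStr := by
  have : Primrec (fun x : BStr × BStr => Nat.bits (Encodable.encode x)) :=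
    cs_primrec_bits.comp Primrec.encode
  exact this

theorem cs_primrec_pow : Primrec₂ ((· ^ ·) : ℕ → ℕ → ℕ) :=
  Primrec₂.unpaired'.1 Nat.Primrec.pow

theorem cs_primrec_replicate : Primrec (fun n : ℕ => List.replicate n false) := by
  have : Primrec (fun n : ℕ => (List.range n).map (fun _ => false)) :=
    Primrec.list_map Primrec.list_range (Primrec.const false).to₂
  exact this.of_eq fun n => by simp

abbrev CsEv := BStr × ℕ × BStr × BStr

/-- `(p,k,z,s)`: program `p` of length `≤ n` halts exactly at stage `k` with output `(z,s)`. -/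
def CsOK (c : Code) (n : ℕ) (e : CsEv) : Prop :=
  e.1.length ≤ n ∧ Code.evaln e.2.1 c (Encodable.encode e.1)
      = some (Encodable.encode (pairStr e.2.2.1 e.2.2.2)) ∧
    Code.evaln (e.2.1 - 1) c (Encodable.encode e.1) = none

theorem cs_primrec_OK (c : Code) : PrimrecRel (CsOK c) := by
  have he : Primrec (fun x : ℕ × CsEv => x.2) := Primrec.snd
  have h1 : Primrec (fun x : ℕ × CsEv => x.2.1) := Primrec.fst.comp he
  have hk : Primrec (fun x : ℕ × CsEv => x.2.2.1) := Primrec.fst.comp (Primrec.snd.comp he)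
  have hz : Primrec (fun x : ℕ × CsEv => x.2.2.2.1) :=
    Primrec.fst.comp (Primrec.snd.comp (Primrec.snd.comp he))
  have hs : Primrec (fun x : ℕ × CsEv => x.2.2.2.2) :=
    Primrec.snd.comp (Primrec.snd.comp (Primrec.snd.comp he))
  have hev : ∀ f : ℕ × CsEv → ℕ, Primrec f →
      Primrec (fun x : ℕ × CsEv => Code.evaln (f x) c (Encodable.encode x.2.1)) := by
    intro f hf
    exact Code.primrec_evaln.comp
      (Primrec.pair (Primrec.pair hf (Primrec.const c)) (Primrec.encode.comp h1))
  refine PrimrecPred.and (Primrec.nat_le.comp (Primrec.list_length.comp h1) Primrec.fst)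
    (PrimrecPred.and (Primrec.eq.comp (hev _ hk) ?_) (Primrec.eq.comp (hev _ ?_) (Primrec.const _)))
  · exact Primrec.option_some.comp (Primrec.encode.comp (cs_primrec_pairStr.comp hz hs))
  · exact Primrec.nat_sub.comp hk (Primrec.const 1)

noncomputable def csEv (c : Code) (n u : ℕ) : Option BStr :=
  (Encodable.decode (α := CsEv) u).bind fun e =>
    if CsOK c n e ∧ Encodable.encode e = u then some e.2.2.1 else none

theorem cs_primrec_ev (c : Code) : Primrec₂ (csEv c) := by
  refine Primrec.option_bind (Primrec.decode.comp Primrec.snd) ?_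
  refine Primrec.ite (PrimrecPred.and
    ((cs_primrec_OK c).comp (Primrec.fst.comp Primrec.fst) Primrec.snd)
    (Primrec.eq.comp (Primrec.encode.comp Primrec.snd) (Primrec.snd.comp Primrec.fst))) ?_
    (Primrec.const none)
  exact Primrec.option_some.comp
    (Primrec.fst.comp (Primrec.snd.comp (Primrec.snd.comp Primrec.snd)))

noncomputable def csCnt (c : Code) (n : ℕ) (o : Option BStr) (u : ℕ) : ℕ :=
  ((List.range u).filter (fun v => csEv c n v = o)).length

theorem cs_primrec_cnt (c : Code) :
    Primrec (fun x : ℕ × Option BStr × ℕ => csCnt c x.1 x.2.1 x.2.2) := by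
  have hR : PrimrecRel (fun (v : ℕ) (b : ℕ × Option BStr) => csEv c b.1 v = b.2) :=
    Primrec.eq.comp ((cs_primrec_ev c).comp (Primrec.fst.comp Primrec.snd) Primrec.fst)
      (Primrec.snd.comp Primrec.snd)
  have h := (PrimrecRel.listFilter hR).comp
    (Primrec.list_range.comp (Primrec.snd.comp (Primrec.snd (α := ℕ) (β := Option BStr × ℕ))))
    (Primrec.pair Primrec.fst (Primrec.fst.comp Primrec.snd))
  exact Primrec.list_length.comp h

def CsSel (c : Code) (n m u : ℕ) : Prop :=
  csEv c n u ≠ none ∧ (csCnt c n (csEv c n u) u + 1) % 2 ^ m = 0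

theorem cs_primrec_sel (c : Code) :
    PrimrecPred (fun x : ℕ × ℕ × ℕ => CsSel c x.1 x.2.1 x.2.2) := by
  have hu : Primrec (fun x : ℕ × ℕ × ℕ => x.2.2) := Primrec.snd.comp Primrec.snd
  have hm : Primrec (fun x : ℕ × ℕ × ℕ => x.2.1) := Primrec.fst.comp Primrec.snd
  have he : Primrec (fun x : ℕ × ℕ × ℕ => csEv c x.1 x.2.2) :=
    (cs_primrec_ev c).comp Primrec.fst hu
  refine PrimrecPred.and (PrimrecPred.not (Primrec.eq.comp he (Primrec.const none))) ?_
  refine Primrec.eq.comp (Primrec.nat_mod.comp (Primrec.nat_add.comp ?_ (Primrec.const 1))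
    (cs_primrec_pow.comp (Primrec.const 2) hm)) (Primrec.const 0)
  exact (cs_primrec_cnt c).comp (Primrec.pair Primrec.fst (Primrec.pair he hu))

noncomputable def csSelCnt (c : Code) (n m u : ℕ) : ℕ :=
  ((List.range u).filter (fun v => CsSel c n m v)).length

theorem cs_primrec_selCnt (c : Code) :
    Primrec (fun x : ℕ × ℕ × ℕ => csSelCnt c x.1 x.2.1 x.2.2) := by
  have hR : PrimrecRel (fun (v : ℕ) (b : ℕ × ℕ) => CsSel c b.1 b.2 v) :=
    (cs_primrec_sel c).comp (Primrec.pair (Primrec.fst.comp Primrec.snd)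
      (Primrec.pair (Primrec.snd.comp Primrec.snd) Primrec.fst))
  have h := (PrimrecRel.listFilter hR).comp
    (Primrec.list_range.comp (Primrec.snd.comp (Primrec.snd (α := ℕ) (β := ℕ × ℕ))))
    (Primrec.pair Primrec.fst (Primrec.fst.comp Primrec.snd))
  exact Primrec.list_length.comp h

/-- Tuples `(r, p, L, u)`. -/
abbrev CsTup := ℕ × BStr × ℕ × ℕ

def csM (e : CsTup) : ℕ := 2 * (e.1 + e.2.1.length)
def csN (e : CsTup) : ℕ := e.2.2.1 + csM e - 1

noncomputable def csEnc (c : Code) (e : CsTup) : BStr :=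
  List.replicate e.1 false ++ (true :: (List.replicate e.2.1.length false ++
    (true :: (e.2.1 ++ natStr (csSelCnt c (csN e) (csM e) e.2.2.2 + 2 ^ e.2.2.1)))))

theorem cs_primrec_M : Primrec csM :=
  Primrec.nat_mul.comp (Primrec.const 2) (Primrec.nat_add.comp Primrec.fst
    (Primrec.list_length.comp (Primrec.fst.comp Primrec.snd)))

theorem cs_primrec_N : Primrec csN :=
  Primrec.nat_sub.comp (Primrec.nat_add.comp (Primrec.fst.comp (Primrec.snd.comp Primrec.snd))
    cs_primrec_M) (Primrec.const 1)

theorem cs_primrec_tsel (c : Code) :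
    PrimrecPred (fun e : CsTup => CsSel c (csN e) (csM e) e.2.2.2) :=
  (cs_primrec_sel c).comp (Primrec.pair cs_primrec_N (Primrec.pair cs_primrec_M
    (Primrec.snd.comp (Primrec.snd.comp Primrec.snd))))

theorem cs_primrec_enc (c : Code) : Primrec (csEnc c) := by
  have hp : Primrec (fun e : CsTup => e.2.1) := Primrec.fst.comp Primrec.snd
  have hL : Primrec (fun e : CsTup => e.2.2.1) := Primrec.fst.comp (Primrec.snd.comp Primrec.snd)
  have hu : Primrec (fun e : CsTup => e.2.2.2) := Primrec.snd.comp (Primrec.snd.comp Primrec.snd)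
  have hc : Primrec (fun e : CsTup => csSelCnt c (csN e) (csM e) e.2.2.2) :=
    (cs_primrec_selCnt c).comp (Primrec.pair cs_primrec_N (Primrec.pair cs_primrec_M hu))
  refine Primrec.list_append.comp (cs_primrec_replicate.comp Primrec.fst) ?_
  refine Primrec.list_cons.comp (Primrec.const true) ?_
  refine Primrec.list_append.comp (cs_primrec_replicate.comp (Primrec.list_length.comp hp)) ?_
  refine Primrec.list_cons.comp (Primrec.const true) ?_
  refine Primrec.list_append.comp hp ?_
  exact cs_primrec_bits.comp (Primrec.nat_add.comp hc (cs_primrec_pow.comp (Primrec.const 2) hL))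

/-- search step -/
noncomputable def csStep (c : Code) (x : BStr) (k : ℕ) : Option CsTup :=
  (Encodable.decode (α := CsTup) k).bind fun e =>
    if CsSel c (csN e) (csM e) e.2.2.2 ∧ csEnc c e = x then some e else none

theorem cs_primrec_step (c : Code) : Primrec₂ (csStep c) := by
  refine Primrec.option_bind (Primrec.decode.comp Primrec.snd) ?_
  refine Primrec.ite (PrimrecPred.and ((cs_primrec_tsel c).comp Primrec.snd)
    (Primrec.eq.comp ((cs_primrec_enc c).comp Primrec.snd) (Primrec.fst.comp Primrec.fst))) ?_
    (Primrec.const none)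
  exact Primrec.option_some.comp Primrec.snd

noncomputable def csD (c : Code) (Vc : BStr → BStr →. BStr) (x : BStr) : Part BStr :=
  (Nat.rfindOpt (csStep c x)).bind fun e =>
    (Vc e.2.1 ((csEv c (csN e) e.2.2.2).getD [])).map fun y => pairStr y (natStr e.2.2.2)

theorem cs_partrec_D (c : Code) (Vc : BStr → BStr →. BStr) (h : Partrec₂ Vc) :
    Partrec (csD c Vc) := by
  have h0 : Partrec (fun x : BStr => Nat.rfindOpt (csStep c x)) :=
    Partrec.rfindOpt (cs_primrec_step c).to_comp
  have hu : Primrec (fun x : BStr × CsTup => x.2.2.2.2) :=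
    Primrec.snd.comp (Primrec.snd.comp (Primrec.snd.comp Primrec.snd))
  have hp : Primrec (fun x : BStr × CsTup => x.2.2.1) :=
    Primrec.fst.comp (Primrec.snd.comp Primrec.snd)
  have hN : Primrec (fun x : BStr × CsTup => csN x.2) := cs_primrec_N.comp Primrec.snd
  have hz0 : Primrec (fun x : BStr × CsTup => csEv c (csN x.2) x.2.2.2.2) :=
    (cs_primrec_ev c).comp hN hu
  have hz : Primrec (fun x : BStr × CsTup => (csEv c (csN x.2) x.2.2.2.2).getD []) :=
    Primrec.option_getD.comp hz0 (Primrec.const [])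
  have h1 : Partrec (fun x : BStr × CsTup =>
      Vc x.2.2.1 ((csEv c (csN x.2) x.2.2.2.2).getD [])) :=
    Partrec₂.comp h hp.to_comp hz.to_comp
  have h2 : Primrec (fun x : (BStr × CsTup) × BStr => pairStr x.2 (natStr x.1.2.2.2.2)) :=
    cs_primrec_pairStr.comp Primrec.snd (cs_primrec_bits.comp (hu.comp Primrec.fst))
  have h3 : Partrec (fun x : BStr × CsTup =>
      (Vc x.2.2.1 ((csEv c (csN x.2) x.2.2.2.2).getD [])).map
        (fun y => pairStr y (natStr x.2.2.2.2))) :=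
    Partrec.map (g := fun (x : BStr × CsTup) (y : BStr) => pairStr y (natStr x.2.2.2.2))
      h1 h2.to_comp
  exact Partrec.bind (g := fun (_ : BStr) (e : CsTup) =>
    (Vc e.2.1 ((csEv c (csN e) e.2.2.2).getD [])).map
        (fun y => pairStr y (natStr e.2.2.2))) h0 h3

theorem cs_natStr_inj : Function.Injective natStr := by
  have h : ∀ n : ℕ, (natStr n).foldr Nat.bit 0 = n := by
    intro n
    unfold natStr
    induction n using Nat.binaryRec' with
    | zero => simp
    | bit b n h ih => rw [Nat.bits_append_bit _ _ h]; simp [ih]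
  intro a b hab
  rw [← h a, ← h b, hab]

theorem cs_pairStr_inj {a b a' b' : BStr} (h : pairStr a b = pairStr a' b') : a = a' ∧ b = b' := by
  have := Encodable.encode_injective (cs_natStr_inj h)
  simpa using this

theorem cs_ev_some {c : Code} {n u : ℕ} {z : BStr} :
    csEv c n u = some z ↔ ∃ e : CsEv, CsOK c n e ∧ Encodable.encode e = u ∧ e.2.2.1 = z := by
  unfold csEv
  rw [Option.bind_eq_some_iff]
  constructor
  · rintro ⟨e, _, he⟩
    split_ifs at he with h
    exact ⟨e, h.1, h.2, by simpa using he⟩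
  · rintro ⟨e, h1, h2, h3⟩
    refine ⟨e, ?_, ?_⟩
    · rw [← h2, Encodable.encodek]
    · rw [if_pos ⟨h1, h2⟩, h3]

theorem cs_OK_unique {c : Code} {n : ℕ} {e e' : CsEv} (h : CsOK c n e) (h' : CsOK c n e')
    (hp : e.1 = e'.1) : e = e' := by
  obtain ⟨p, k, z, s⟩ := e
  obtain ⟨p', k', z', s'⟩ := e'
  obtain ⟨_, h1, h2⟩ := h
  obtain ⟨_, h1', h2'⟩ := h'
  simp only at hp h1 h2 h1' h2'
  subst hp
  have key : ∀ {k k' a b}, Code.evaln k c (Encodable.encode p) = some a →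
      Code.evaln (k' - 1) c (Encodable.encode p) = none →
      Code.evaln k' c (Encodable.encode p) = some b → k' ≤ k := by
    intro k k' a b ha hb _
    by_contra hlt
    have : a ∈ Code.evaln (k' - 1) c (Encodable.encode p) :=
      Code.evaln_mono (by omega) (Option.mem_def.2 ha)
    rw [hb] at this
    simp at this
  have hk : k = k' := le_antisymm (key h1' h2 h1) (key h1 h2' h1')
  subst hk
  rw [h1] at h1'
  have := cs_pairStr_inj (Encodable.encode_injective (Option.some.inj h1'))
  rw [this.1, this.2]

/-- Strings of length at most `n`. -/
def csStrs : ℕ → Finset BStr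
  | 0 => {[]}
  | n + 1 => insert [] ((csStrs n).image (List.cons true) ∪ (csStrs n).image (List.cons false))

theorem cs_mem_strs (n : ℕ) (p : BStr) (h : p.length ≤ n) : p ∈ csStrs n := by
  induction n generalizing p with
  | zero => simp [csStrs]; simpa using h
  | succ n ih =>
    rcases p with _ | ⟨b, p⟩
    · simp [csStrs]
    · have := ih p (by simpa using h)
      cases b <;> simp [csStrs, this]

theorem cs_card_strs (n : ℕ) : (csStrs n).card + 1 ≤ 2 ^ (n + 1) := by
  induction n with
  | zero => simp [csStrs]
  | succ n ih =>
    have h1 := Finset.card_insert_le ([] : BStr)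
      ((csStrs n).image (List.cons true) ∪ (csStrs n).image (List.cons false))
    have h2 := Finset.card_union_le ((csStrs n).image (List.cons true))
      ((csStrs n).image (List.cons false))
    have h3 := Finset.card_image_le (s := csStrs n) (f := List.cons true)
    have h4 := Finset.card_image_le (s := csStrs n) (f := List.cons false)
    have h5 : (csStrs (n + 1)).card ≤ 1 + ((csStrs n).card + (csStrs n).card) := by
      simp only [csStrs]
      omega
    rw [pow_succ]
    omega

/-- program part of an event -/
noncomputable def csProg (u : ℕ) : BStr := ((Encodable.decode (α := CsEv) u).getD ([], 0, [], [])).1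

theorem cs_prog_maps (c : Code) (n : ℕ) :
    Set.MapsTo csProg {u | csEv c n u ≠ none} (csStrs n : Set BStr) := by
  intro u hu
  obtain ⟨z, hz⟩ := Option.ne_none_iff_exists'.1 hu
  obtain ⟨e, h1, h2, _⟩ := cs_ev_some.1 hz
  have : csProg u = e.1 := by rw [csProg, ← h2, Encodable.encodek]; rfl
  rw [this]
  exact cs_mem_strs _ _ h1.1

theorem cs_prog_inj (c : Code) (n : ℕ) :
    Set.InjOn csProg {u | csEv c n u ≠ none} := by
  intro u hu u' hu' heq
  obtain ⟨z, hz⟩ := Option.ne_none_iff_exists'.1 hu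
  obtain ⟨e, h1, h2, _⟩ := cs_ev_some.1 hz
  have h3 : csProg u = e.1 := by rw [csProg, ← h2, Encodable.encodek]; rfl
  obtain ⟨z', hz'⟩ := Option.ne_none_iff_exists'.1 hu'
  obtain ⟨e', h1', h2', _⟩ := cs_ev_some.1 hz'
  have h3' : csProg u' = e'.1 := by rw [csProg, ← h2', Encodable.encodek]; rfl
  have : e = e' := cs_OK_unique h1 h1' (by rw [← h3, ← h3', heq])
  rw [← h2, ← h2', this]

theorem cs_bound (c : Code) (n : ℕ) : ∃ B, ∀ u, csEv c n u ≠ none → u < B := by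
  have : Set.Finite {u | csEv c n u ≠ none} :=
    Set.Finite.of_injOn (cs_prog_maps c n) (cs_prog_inj c n) (Finset.finite_toSet _)
  obtain ⟨B, hB⟩ := this.bddAbove
  exact ⟨B + 1, fun u hu => Nat.lt_succ_of_le (hB hu)⟩

theorem cs_total (c : Code) (n B : ℕ) :
    ((Finset.range B).filter (fun u => csEv c n u ≠ none)).card + 1 ≤ 2 ^ (n + 1) := by
  refine le_trans (Nat.add_le_add_right ?_ 1) (cs_card_strs n)
  apply Finset.card_le_card_of_injOn csProg
  · intro u hu
    exact cs_prog_maps c n (by simpa using (Finset.mem_filter.1 hu).2)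
  · intro u hu v hv h
    exact cs_prog_inj c n (Finset.mem_filter.1 hu).2 (Finset.mem_filter.1 hv).2 h

theorem cs_cnt_eq (c : Code) (n : ℕ) (o : Option BStr) (B : ℕ) :
    csCnt c n o B = ((Finset.range B).filter (fun u => csEv c n u = o)).card := by
  simp [csCnt, Finset.card, Finset.filter, Finset.range, Multiset.range]

theorem cs_selCnt_eq (c : Code) (n m B : ℕ) :
    csSelCnt c n m B = ((Finset.range B).filter (fun u => CsSel c n m u)).card := by
  simp [csSelCnt, Finset.card, Finset.filter, Finset.range, Multiset.range]

theorem cs_cnt_succ (c : Code) (n : ℕ) (o : Option BStr) (B : ℕ) :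
    csCnt c n o (B + 1) = csCnt c n o B + if csEv c n B = o then 1 else 0 := by
  unfold csCnt
  rw [List.range_succ, List.filter_append]
  split_ifs with h <;> simp [h]

theorem cs_selCnt_succ (c : Code) (n m B : ℕ) :
    csSelCnt c n m (B + 1) = csSelCnt c n m B + if CsSel c n m B then 1 else 0 := by
  unfold csSelCnt
  rw [List.range_succ, List.filter_append]
  split_ifs with h <;> simp [h]

theorem cs_fiber (c : Code) (n m : ℕ) (z : BStr) (B : ℕ) :
    ((Finset.range B).filter (fun u => CsSel c n m u ∧ csEv c n u = some z)).card
      = csCnt c n (some z) B / 2 ^ m := by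
  induction B with
  | zero => simp [csCnt]
  | succ B ih =>
    rw [Finset.range_add_one, Finset.filter_insert, cs_cnt_succ]
    by_cases h : csEv c n B = some z
    · rw [if_pos h, Nat.succ_div, ← ih]
      have : CsSel c n m B ↔ 2 ^ m ∣ csCnt c n (some z) B + 1 := by
        unfold CsSel
        rw [h, Nat.dvd_iff_mod_eq_zero]
        simp
      by_cases h2 : 2 ^ m ∣ csCnt c n (some z) B + 1
      · rw [if_pos ⟨this.2 h2, h⟩, if_pos h2, Finset.card_insert_of_notMem (by simp)]
      · rw [if_neg (fun hh => h2 (this.1 hh.1)), if_neg h2]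
        rfl
    · rw [if_neg (fun hh => h hh.2), if_neg h, ih]
      rfl

theorem cs_sel_total (c : Code) (n m B : ℕ) :
    csSelCnt c n m B * 2 ^ m + 1 ≤ 2 ^ (n + 1) := by
  refine le_trans (Nat.add_le_add_right ?_ 1) (cs_total c n B)
  set I := (Finset.range B).image (csEv c n) with hI
  rw [cs_selCnt_eq]
  rw [Finset.card_eq_sum_card_fiberwise (f := csEv c n) (t := I)
    (s := (Finset.range B).filter (fun u => CsSel c n m u)),
    Finset.card_eq_sum_card_fiberwise (f := csEv c n) (t := I)
    (s := (Finset.range B).filter (fun u => csEv c n u ≠ none)), Finset.sum_mul]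
  · apply Finset.sum_le_sum
    intro o _
    rw [Finset.filter_filter, Finset.filter_filter]
    rcases o with _ | z
    · have : ((Finset.range B).filter (fun u => CsSel c n m u ∧ csEv c n u = none)) = ∅ := by
        apply Finset.filter_false_of_mem
        rintro u _ ⟨h, h'⟩
        exact h.1 h'
      rw [this]
      simp
    · rw [cs_fiber]
      refine le_trans (Nat.div_mul_le_self _ _) ?_
      rw [cs_cnt_eq]
      apply Finset.card_le_card
      intro u hu
      simp only [Finset.mem_filter] at hu ⊢
      exact ⟨hu.1, by simp [hu.2], hu.2⟩
  · intro u hu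
    exact Finset.mem_image_of_mem _ (Finset.mem_filter.1 hu).1
  · intro u hu
    exact Finset.mem_image_of_mem _ (Finset.mem_filter.1 hu).1

theorem cs_selCnt_mono (c : Code) (n m : ℕ) : Monotone (csSelCnt c n m) := by
  apply monotone_nat_of_le_succ
  intro u
  rw [cs_selCnt_succ]
  omega

theorem cs_selCnt_inj {c : Code} {n m u v : ℕ} (hu : CsSel c n m u) (hv : CsSel c n m v)
    (h : csSelCnt c n m u = csSelCnt c n m v) : u = v := by
  have key : ∀ {a b}, CsSel c n m a → a < b → csSelCnt c n m a < csSelCnt c n m b := by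
    intro a b ha hab
    have h1 := cs_selCnt_mono c n m (Nat.succ_le_of_lt hab)
    have h2 := cs_selCnt_succ c n m a
    rw [if_pos ha] at h2
    simp only [Nat.succ_eq_add_one] at h1
    omega
  rcases lt_trichotomy u v with hl | hl | hl
  · have := key hu hl; omega
  · exact hl
  · have := key hv hl; omega

theorem cs_selCnt_lt {c : Code} {e : CsTup} (h : CsSel c (csN e) (csM e) e.2.2.2) :
    csSelCnt c (csN e) (csM e) e.2.2.2 < 2 ^ e.2.2.1 := by
  have h1 := cs_sel_total c (csN e) (csM e) (e.2.2.2 + 1)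
  rw [cs_selCnt_succ, if_pos h] at h1
  by_cases h0 : e.2.2.1 + csM e = 0
  · have hN : csN e = 0 := by unfold csN; omega
    have hM : csM e = 0 := by omega
    rw [hN, hM] at h1 ⊢
    have : 0 < 2 ^ e.2.2.1 := by positivity
    simp at h1
    omega
  · have hN : csN e + 1 = e.2.2.1 + csM e := by unfold csN; omega
    rw [hN, pow_add] at h1
    have h2 : 0 < 2 ^ csM e := by positivity
    have : csSelCnt c (csN e) (csM e) e.2.2.2 + 1 ≤ 2 ^ e.2.2.1 :=
      Nat.le_of_mul_le_mul_right (by omega) h2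
    omega

theorem cs_natStr_len {i L : ℕ} (h : i < 2 ^ L) : (natStr (i + 2 ^ L)).length = L + 1 := by
  rw [natStr, Nat.size_eq_bits_len]
  apply le_antisymm
  · rw [Nat.size_le, pow_succ]; omega
  · have : L < Nat.size (i + 2 ^ L) := Nat.lt_size.2 (by omega)
    omega

theorem cs_enc_len {c : Code} {e : CsTup} (h : CsSel c (csN e) (csM e) e.2.2.2) :
    (csEnc c e).length = e.1 + 2 * e.2.1.length + e.2.2.1 + 3 := by
  unfold csEnc
  simp only [List.length_append, List.length_cons, List.length_replicate,
    cs_natStr_len (cs_selCnt_lt h)]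
  ring

theorem cs_unary_inj : ∀ {r r' : ℕ} {l l' : BStr},
    List.replicate r false ++ (true :: l) = List.replicate r' false ++ (true :: l') →
    r = r' ∧ l = l'
  | 0, 0, l, l', h => by simpa using h
  | 0, r' + 1, l, l', h => by simp [List.replicate_succ] at h
  | r + 1, 0, l, l', h => by simp [List.replicate_succ] at h
  | r + 1, r' + 1, l, l', h => by
    simp only [List.replicate_succ, List.cons_append, List.cons.injEq, true_and] at h
    have := cs_unary_inj h
    exact ⟨by rw [this.1], this.2⟩

theorem cs_enc_inj {c : Code} {e e' : CsTup} (h : CsSel c (csN e) (csM e) e.2.2.2)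
    (h' : CsSel c (csN e') (csM e') e'.2.2.2) (heq : csEnc c e = csEnc c e') : e = e' := by
  have hlt := cs_natStr_len (cs_selCnt_lt h)
  have hlt' := cs_natStr_len (cs_selCnt_lt h')
  obtain ⟨r, p, L, u⟩ := e
  obtain ⟨r', p', L', u'⟩ := e'
  unfold csEnc at heq
  obtain ⟨h1, h2⟩ := cs_unary_inj heq
  obtain ⟨h3, h4⟩ := cs_unary_inj h2
  obtain ⟨h5, h6⟩ := List.append_inj h4 h3
  simp only at h1 h5
  subst h1 h5
  have hL : L = L' := by
    have := congrArg List.length h6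
    rw [hlt, hlt'] at this
    simpa using this
  subst hL
  have h7 := cs_natStr_inj h6
  have h8 := cs_selCnt_inj (u := u) (v := u') h h' (by
    simp only [csN, csM] at h7 ⊢
    omega)
  rw [h8]

theorem cs_D_spec {c : Code} {Vc : BStr → BStr →. BStr} {e : CsTup} {y z : BStr}
    (h : CsSel c (csN e) (csM e) e.2.2.2) (hz : csEv c (csN e) e.2.2.2 = some z)
    (hy : y ∈ Vc e.2.1 z) : pairStr y (natStr e.2.2.2) ∈ csD c Vc (csEnc c e) := by
  have hd : (Nat.rfindOpt (csStep c (csEnc c e))).Dom := by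
    rw [Nat.rfindOpt_dom]
    refine ⟨Encodable.encode e, e, ?_⟩
    simp [csStep, Encodable.encodek, h]
  obtain ⟨e', he'⟩ := Part.dom_iff_mem.1 hd
  obtain ⟨k, hk⟩ := Nat.rfindOpt_spec he'
  have : e' = e := by
    unfold csStep at hk
    rw [Option.mem_def, Option.bind_eq_some_iff] at hk
    obtain ⟨e'', _, h2⟩ := hk
    split_ifs at h2 with h3
    have h4 : e'' = e' := by simpa using h2
    subst h4
    exact cs_enc_inj h3.1 h h3.2
  subst this
  unfold csD
  refine Part.mem_bind he' ?_
  refine Part.mem_map _ ?_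
  rw [hz]
  exact hy

theorem cs_plainC_le {D : BStr →. BStr} {x p : BStr} (h : x ∈ D p) : plainC D x ≤ p.length :=
  Nat.sInf_le ⟨p, rfl, h⟩

theorem cs_plainC_spec {D : BStr →. BStr} {x : BStr} (h : ∃ p, x ∈ D p) :
    ∃ p : BStr, p.length = plainC D x ∧ x ∈ D p := by
  obtain ⟨p, hp⟩ := h
  exact Nat.sInf_mem (s := {n | ∃ p : BStr, p.length = n ∧ x ∈ D p}) ⟨_, p, rfl, hp⟩

theorem cs_condC_spec {D : BStr → BStr →. BStr} {x y : BStr} (h : ∃ p, x ∈ D p y) :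
    ∃ p : BStr, p.length = condC D x y ∧ x ∈ D p y := by
  obtain ⟨p, hp⟩ := h
  exact Nat.sInf_mem (s := {n | ∃ p : BStr, p.length = n ∧ x ∈ D p y}) ⟨_, p, rfl, hp⟩

theorem cs_code (V : BStr →. BStr) (h : Partrec V) :
    ∃ c : Code, ∀ p x, x ∈ V p → Encodable.encode x ∈ c.eval (Encodable.encode p) := by
  obtain ⟨c, hc⟩ := Code.exists_code.1 h
  refine ⟨c, fun p x hx => ?_⟩
  rw [hc]
  simp only [Encodable.encodek]
  simpa using hx

theorem cs_ev_of_mem {O : OptimalDecompressor} {c : Code}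
    (hc : ∀ p x, x ∈ O.V p → Encodable.encode x ∈ c.eval (Encodable.encode p))
    {n : ℕ} {z s : BStr} (hs : plainC O.V (pairStr z s) ≤ n) :
    ∃ e : CsEv, CsOK c n e ∧ e.2.2 = (z, s) := by
  obtain ⟨p, hp, hV⟩ := cs_plainC_spec (O.onto (pairStr z s))
  have h1 := Code.evaln_complete.1 (hc _ _ hV)
  have h2 := Nat.find_spec h1
  refine ⟨(p, Nat.find h1, z, s), ⟨by simp only; omega, h2, ?_⟩, rfl⟩
  simp only
  rw [Option.eq_none_iff_forall_ne_some]
  intro a ha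
  have hpos : 0 < Nat.find h1 := by
    have := Code.evaln_bound h2
    omega
  have h3 : a ∈ Code.evaln (Nat.find h1) c (Encodable.encode p) :=
    Code.evaln_mono (by omega) (Option.mem_def.2 ha)
  have h4 : a = Encodable.encode (pairStr z s) := Option.mem_unique h3 h2
  subst h4
  exact Nat.find_min h1 (m := Nat.find h1 - 1) (by omega) ha

theorem cs_T_card {O : OptimalDecompressor} {c : Code}
    (hc : ∀ p x, x ∈ O.V p → Encodable.encode x ∈ c.eval (Encodable.encode p))
    (t : ℕ) (z : BStr) (B : ℕ) (hB : ∀ u, csEv c (2 ^ t) u ≠ none → u < B) :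
    (Tset O t z).Finite ∧ (Tset O t z).ncard ≤ csCnt c (2 ^ t) (some z) B := by
  have h : ∀ s, ∃ e : CsEv, s ∈ Tset O t z → CsOK c (2 ^ t) e ∧ e.2.2 = (z, s) := by
    intro s
    by_cases hs : s ∈ Tset O t z
    · obtain ⟨e, he⟩ := cs_ev_of_mem hc hs
      exact ⟨e, fun _ => he⟩
    · exact ⟨([], 0, [], []), fun h => absurd h hs⟩
  choose f hf using h
  have hmaps : Set.MapsTo (fun s => Encodable.encode (f s)) (Tset O t z)
      ((Finset.range B).filter (fun u => csEv c (2 ^ t) u = some z) : Finset ℕ) := by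
    intro s hs
    have h1 : csEv c (2 ^ t) (Encodable.encode (f s)) = some z :=
      cs_ev_some.2 ⟨f s, (hf s hs).1, rfl, by rw [(hf s hs).2]⟩
    simp only [Finset.coe_filter, Finset.mem_range, Set.mem_ofPred_eq]
    exact ⟨hB _ (by simp [h1]), h1⟩
  have hinj : Set.InjOn (fun s => Encodable.encode (f s)) (Tset O t z) := by
    intro s hs s' hs' heq
    have h1 : f s = f s' := Encodable.encode_injective heq
    have h2 := (hf s hs).2
    rw [h1, (hf s' hs').2] at h2
    exact (Prod.mk.inj h2).2.symm
  refine ⟨Set.Finite.of_injOn hmaps hinj (Finset.finite_toSet _), ?_⟩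
  rw [cs_cnt_eq, ← Set.ncard_coe_finset]
  exact Set.ncard_le_ncard_of_injOn _ hmaps hinj (Finset.finite_toSet _)

/-- Conditioning shift: there is a constant `c` such that for
every `t` and all strings (or tuples) `y, z` with `|y|, |z| < 2^t/2 − c`:
`|T_t(y)| ≥ |T_t(z)| · 2^{−cδ − c}` where `δ = C_V(y | z)`. -/
theorem conditioning_shift (O : OptimalDecompressor) (Oc : CondOptimalDecompressor) :
    ∃ c : ℕ, ∀ t : ℕ, ∀ y z : BStr,
      2 * (y.length + c) < 2 ^ t → 2 * (z.length + c) < 2 ^ t →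
      (Tset O t z).ncard ≤ (Tset O t y).ncard * 2 ^ (c * condC Oc.Vc y z + c) := by
  obtain ⟨c, hc⟩ := cs_code O.V O.partrec
  obtain ⟨M, hM⟩ := O.optimal (csD c Oc.Vc) (cs_partrec_D c Oc.Vc Oc.partrec)
  have hP : Partrec (fun p : BStr => Part.some (pairStr p [])) := by
    have h : Primrec (fun p : BStr => pairStr p []) :=
      cs_primrec_pairStr.comp Primrec.id (Primrec.const [])
    exact h.to_comp
  obtain ⟨M', hM'⟩ := O.optimal _ hP
  refine ⟨2 * M + 9 + M', ?_⟩
  intro t y z hy _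
  obtain ⟨B, hB⟩ := cs_bound c (2 ^ t)
  obtain ⟨hfin, _⟩ := cs_T_card hc t y B hB
  obtain ⟨_, hz⟩ := cs_T_card hc t z B hB
  have hne : 1 ≤ (Tset O t y).ncard := by
    refine (Set.ncard_pos hfin).2 ?_
    refine ⟨[], ?_⟩
    have h1 : pairStr y [] ∈ (fun p : BStr => Part.some (pairStr p [])) y := Part.mem_some _
    have h2 := hM' _ ⟨y, h1⟩
    have h3 := cs_plainC_le (D := fun p : BStr => Part.some (pairStr p [])) h1
    show plainC O.V (pairStr y []) ≤ 2 ^ t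
    omega
  obtain ⟨p, hp, hVp⟩ := cs_condC_spec (Oc.onto y z)
  set δ := condC Oc.Vc y z with hδ
  set m := 2 * ((M + 4) + δ) with hm
  have hexp : m + 1 ≤ (2 * M + 9 + M') * δ + (2 * M + 9 + M') := by nlinarith
  suffices hmain : (Tset O t z).ncard ≤ (Tset O t y).ncard * 2 ^ (m + 1) from
    hmain.trans (Nat.mul_le_mul_left _ (Nat.pow_le_pow_right (by norm_num) hexp))
  by_cases hcase : 2 ^ t + 1 < m
  · have h1 : csCnt c (2 ^ t) (some z) B ≤ 2 ^ (2 ^ t + 1) := by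
      have h2 := cs_total c (2 ^ t) B
      refine le_trans ?_ (le_trans (Nat.le_succ _) h2)
      rw [cs_cnt_eq]
      apply Finset.card_le_card
      intro u hu
      simp only [Finset.mem_filter] at hu ⊢
      exact ⟨hu.1, by simp [hu.2]⟩
    have h3 : 2 ^ (2 ^ t + 1) ≤ 2 ^ (m + 1) := Nat.pow_le_pow_right (by norm_num) (by omega)
    nlinarith
  · have hsub : (((Finset.range B).filter
        (fun u => CsSel c (2 ^ t) m u ∧ csEv c (2 ^ t) u = some z)).image natStr : Finset BStr)
        ⊆ hfin.toFinset := by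
      intro s hs
      obtain ⟨u, hu, rfl⟩ := Finset.mem_image.1 hs
      obtain ⟨_, hsel, hev⟩ := Finset.mem_filter.1 hu
      rw [Set.Finite.mem_toFinset]
      show plainC O.V (pairStr y (natStr u)) ≤ 2 ^ t
      let e : CsTup := (M + 4, p, 2 ^ t + 1 - m, u)
      have heM : csM e = m := by simp only [csM, e, hp, hm]
      have heN : csN e = 2 ^ t := by
        unfold csN
        rw [heM]
        simp only [e]
        omega
      have hsel' : CsSel c (csN e) (csM e) e.2.2.2 := by rw [heM, heN]; exact hsel
      have hD := cs_D_spec (Vc := Oc.Vc) (y := y) (z := z) hsel' (by rw [heN]; exact hev) hVp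
      have h1 := hM _ ⟨_, hD⟩
      have h2 := cs_plainC_le hD
      rw [cs_enc_len hsel'] at h2
      simp only [e, hp] at h1 h2
      omega
    have hcard := Finset.card_le_card hsub
    rw [Finset.card_image_of_injective _ cs_natStr_inj, cs_fiber,
      ← Set.ncard_eq_toFinset_card _ hfin] at hcard
    have h2 : 0 < 2 ^ m := by positivity
    have h3 := Nat.lt_mul_div_succ (csCnt c (2 ^ t) (some z) B) h2
    calc (Tset O t z).ncard ≤ csCnt c (2 ^ t) (some z) B := hz
      _ ≤ 2 ^ m * (csCnt c (2 ^ t) (some z) B / 2 ^ m + 1) := h3.le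
      _ ≤ 2 ^ m * ((Tset O t y).ncard + (Tset O t y).ncard) :=
        Nat.mul_le_mul_left _ (by omega)
      _ = (Tset O t y).ncard * 2 ^ (m + 1) := by ring
end

section
/- There exists a constant c such that for every integer n and every integer q ≥ c there exists an integer l* with 0 ≤ l* ≤ q − 1 and |β(l*) − l*| ≤ c, where for 0 ≤ l ≤ q one sets T_l = (q, l) (a pair encoded by a fixed computable pairing), α(l) = K(T_l | n), and β(l) = K(T_l, α(l) | q). -/
open scoped Classical ENNReal

/-- Binary increment on little-endian bit lists. -/
def incrBits : BStr → BStr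
  | [] => [true]
  | false :: l => true :: l
  | true :: l => false :: incrBits l

theorem natStr_bit (b : Bool) (n : ℕ) (h : n = 0 → b = true) :
    natStr (Nat.bit b n) = b :: natStr n := Nat.bits_append_bit n b h

theorem natStr_succ (n : ℕ) : natStr (n + 1) = incrBits (natStr n) := by
  induction n using Nat.binaryRec' with
  | zero => simp [natStr, incrBits]
  | bit b n h ih =>
    rw [natStr_bit b n h]
    cases b with
    | false =>
      have e : Nat.bit false n + 1 = Nat.bit true n := by simp [Nat.bit]
      rw [e, natStr_bit true n (fun _ => rfl)]
      rfl
    | true =>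
      have e : Nat.bit true n + 1 = Nat.bit false (n + 1) := by simp [Nat.bit]; ring
      rw [e, natStr_bit false (n + 1) (by simp), ih]
      rfl

theorem incrBits_primrec : Primrec incrBits := by
  have h : Primrec (fun l : BStr => (List.recOn l [true]
      (fun b l ih => bif b then false :: ih else true :: l) : BStr)) := by
    refine Primrec.list_rec (f := fun l : BStr => l) (g := fun _ : BStr => ([true] : BStr))
      (h := fun (_ : BStr) (p : Bool × BStr × BStr) =>
        bif p.1 then false :: p.2.2 else true :: p.2.1)
      Primrec.id (Primrec.const _) ?_
    have h1 : Primrec (fun a : BStr × (Bool × BStr × BStr) => false :: a.2.2.2) :=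
      Primrec.list_cons.comp (Primrec.const false)
        (Primrec.snd.comp (Primrec.snd.comp Primrec.snd))
    have h2 : Primrec (fun a : BStr × (Bool × BStr × BStr) => true :: a.2.2.1) :=
      Primrec.list_cons.comp (Primrec.const true)
        (Primrec.fst.comp (Primrec.snd.comp Primrec.snd))
    exact (Primrec.cond (Primrec.fst.comp Primrec.snd) h1 h2).to₂
  refine h.of_eq ?_
  intro l
  induction l with
  | nil => rfl
  | cons b l ih =>
    cases b with
    | false => rfl
    | true => simp only [incrBits, ← ih]; rfl

theorem natStr_primrec : Primrec natStr := by
  have h : Primrec (fun n : ℕ => (Nat.rec ([] : BStr) (fun _ ih => incrBits ih) n : BStr)) :=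
    Primrec.nat_rec₁ (f := fun _ ih => incrBits ih) [] (incrBits_primrec.comp Primrec.snd).to₂
  refine h.of_eq ?_
  intro n
  induction n with
  | zero => simp [natStr]
  | succ n ih => rw [natStr_succ, ← ih]

/-- Inverse of `natStr`. -/
def natOf (l : BStr) : ℕ := l.foldr (fun b n => 2 * n + b.toNat) 0

theorem natOf_natStr (n : ℕ) : natOf (natStr n) = n := by
  induction n using Nat.binaryRec' with
  | zero => simp [natStr, natOf]
  | bit b n h ih =>
    rw [natStr_bit b n h]
    have : natOf (b :: natStr n) = 2 * natOf (natStr n) + b.toNat := rfl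
    rw [this, ih, Nat.bit_val]

theorem natOf_primrec : Primrec natOf := by
  refine Primrec.list_foldr (f := fun l : BStr => l) (g := fun _ : BStr => (0 : ℕ))
    (h := fun (_ : BStr) (p : Bool × ℕ) => 2 * p.2 + p.1.toNat)
    Primrec.id (Primrec.const _) ?_
  have h1 : Primrec (fun a : BStr × (Bool × ℕ) => a.2.1.toNat) :=
    (Primrec.dom_finite Bool.toNat).comp (Primrec.fst.comp Primrec.snd)
  have h2 : Primrec (fun a : BStr × (Bool × ℕ) => 2 * a.2.2) :=
    Primrec.nat_mul.comp (Primrec.const 2) (Primrec.snd.comp Primrec.snd)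
  exact (Primrec.nat_add.comp h2 h1).to₂

/-- Self-delimiting code of a bit list. -/
def selfCode (l : BStr) : BStr := l.foldr (fun b acc => true :: b :: acc) [false]

theorem selfCode_primrec : Primrec selfCode := by
  refine Primrec.list_foldr (f := fun l : BStr => l) (g := fun _ : BStr => ([false] : BStr))
    (h := fun (_ : BStr) (p : Bool × BStr) => true :: p.1 :: p.2)
    Primrec.id (Primrec.const _) ?_
  exact (Primrec.list_cons.comp (Primrec.const true)
    (Primrec.list_cons.comp (Primrec.fst.comp Primrec.snd)
      (Primrec.snd.comp Primrec.snd))).to₂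

theorem selfCode_cons (b : Bool) (l : BStr) : selfCode (b :: l) = true :: b :: selfCode l := rfl

theorem selfCode_length (l : BStr) : (selfCode l).length = 2 * l.length + 1 := by
  induction l with
  | nil => rfl
  | cons b l ih => rw [selfCode_cons]; simp only [List.length_cons, ih]; ring

theorem selfCode_prefix (l m : BStr) (h : selfCode l <+: selfCode m) : l = m := by
  induction l generalizing m with
  | nil =>
    cases m with
    | nil => rfl
    | cons b m => simp [selfCode] at h
  | cons a l ih =>
    cases m with
    | nil => simp [selfCode] at h
    | cons b m =>
      rw [selfCode_cons, selfCode_cons, List.cons_prefix_cons, List.cons_prefix_cons] at h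
      rw [h.2.1, ih m h.2.2]

theorem K_spec (U : UniversalPrefixDecompressor) (x y : BStr) :
    ∃ p : BStr, p.length = K U x y ∧ x ∈ U.D p y := by
  have hne : {n | ∃ p : BStr, p.length = n ∧ x ∈ U.D p y}.Nonempty := by
    obtain ⟨p, hp⟩ := U.onto x y
    exact ⟨_, p, rfl, hp⟩
  exact Nat.sInf_mem hne

theorem condC_le {D : BStr → BStr →. BStr} {x y p : BStr} (h : x ∈ D p y) :
    condC D x y ≤ p.length := Nat.sInf_le ⟨p, rfl, h⟩

/-- Applying a computable function does not increase the complexity. -/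
theorem K_map (U : UniversalPrefixDecompressor) (f : BStr → BStr) (hf : Computable f) :
    ∃ c : ℕ, ∀ x y : BStr, K U (f x) y ≤ K U x y + c := by
  obtain ⟨c, hc⟩ := U.universal (fun p y => (U.D p y).map f)
    (by
      have h : Partrec (fun a : BStr × BStr => (U.D a.1 a.2).map f) :=
        Partrec.map U.partrec (hf.comp Computable.snd).to₂
      exact h)
    (by
      intro y p q hp hq hpq
      exact U.prefixFree y p q hp hq hpq)
  refine ⟨c, fun x y => ?_⟩
  obtain ⟨p, hp, hx⟩ := K_spec U x y
  have hm : f x ∈ (U.D p y).map f := Part.mem_map f hx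
  have h1 := hc (f x) y ⟨p, hm⟩
  have h2 : condC (fun p y => (U.D p y).map f) (f x) y ≤ p.length := condC_le hm
  unfold K at *
  omega

/-- Crude logarithmic upper bound. -/
theorem K_log (U : UniversalPrefixDecompressor) (f : ℕ → BStr) (hf : Computable f) :
    ∃ c : ℕ, ∀ (m : ℕ) (y : BStr), K U (f m) y ≤ 2 * Nat.size m + c := by
  let D' : BStr → BStr →. BStr := fun p _ =>
    (Nat.rfind (fun m => Part.some (decide (selfCode (natStr m) = p)))).map f
  have hinj : ∀ a b, selfCode (natStr a) = selfCode (natStr b) → a = b := by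
    intro a b h
    have h2 := selfCode_prefix (natStr a) (natStr b) (by rw [h])
    rw [← natOf_natStr a, h2, natOf_natStr]
  have hfind : ∀ p m, m ∈ Nat.rfind (fun m => Part.some (decide (selfCode (natStr m) = p))) ↔
      selfCode (natStr m) = p := by
    intro p m
    refine Nat.mem_rfind.trans ?_
    constructor
    · rintro ⟨h, -⟩
      simpa using h
    · intro h
      refine ⟨by simpa using h, ?_⟩
      intro k hk
      have : selfCode (natStr k) ≠ p := by
        intro h'
        have := hinj k m (h'.trans h.symm)
        omega
      simpa using this
  have hrec : Partrec₂ D' := by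
    have hp : Partrec₂ (fun (a : BStr × BStr) (m : ℕ) =>
        (Part.some (decide (selfCode (natStr m) = a.1)) : Part Bool)) := by
      have h0 : Primrec (fun a : (BStr × BStr) × ℕ => decide (selfCode (natStr a.2) = a.1.1)) := by
        have := (Primrec.eq (α := BStr)).comp
          ((selfCode_primrec.comp natStr_primrec).comp (Primrec.snd (α := BStr × BStr) (β := ℕ)))
          (Primrec.fst.comp (Primrec.fst (α := BStr × BStr) (β := ℕ)))
        exact this.decide
      exact h0.to_comp.partrec
    have h : Partrec (fun a : BStr × BStr =>
        (Nat.rfind (fun m => Part.some (decide (selfCode (natStr m) = a.1)))).map f) :=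
      Partrec.map (Partrec.rfind hp) (hf.comp Computable.snd).to₂
    exact h
  have hpf : PrefixFreeDom D' := by
    intro y p q hp hq hpq
    obtain ⟨a, ha⟩ := Part.dom_iff_mem.1
      (show (Nat.rfind (fun m => Part.some (decide (selfCode (natStr m) = p)))).Dom from hp)
    obtain ⟨b, hb⟩ := Part.dom_iff_mem.1
      (show (Nat.rfind (fun m => Part.some (decide (selfCode (natStr m) = q)))).Dom from hq)
    rw [hfind] at ha hb
    rw [← ha, ← hb] at hpq ⊢
    rw [selfCode_prefix _ _ hpq]
  obtain ⟨c, hc⟩ := U.universal D' hrec hpf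
  refine ⟨c + 1, fun m y => ?_⟩
  have hm : f m ∈ D' (selfCode (natStr m)) y :=
    Part.mem_map f ((hfind _ _).2 rfl)
  have h1 := hc (f m) y ⟨_, hm⟩
  have h2 := condC_le hm
  rw [selfCode_length] at h2
  have h3 : (natStr m).length = Nat.size m := (Nat.size_eq_bits_len m)
  unfold K
  omega

theorem size_small (a b : ℕ) : ∃ N, ∀ q, N ≤ q → a * Nat.size q + b ≤ q := by
  refine ⟨2 ^ (2 * (4 * a + b + 1) + 1), fun q hq => ?_⟩
  have hs : 2 * (4 * a + b + 1) + 1 < Nat.size q := Nat.lt_size.2 hq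
  set s := Nat.size q with hsdef
  obtain ⟨m, hm⟩ : ∃ m, m = (s - 1) / 2 := ⟨_, rfl⟩
  have hpow : 2 ^ (2 * m) ≤ q := Nat.lt_size.1 (by omega)
  have h1 : m < 2 ^ m := Nat.lt_two_pow_self
  have h2 : m * m ≤ q := by
    calc m * m ≤ 2 ^ m * 2 ^ m := Nat.mul_le_mul h1.le h1.le
      _ = 2 ^ (2 * m) := by rw [two_mul, pow_add]
      _ ≤ q := hpow
  have h3 : s ≤ 2 * m + 2 := by omega
  have h4 : 4 * a + b + 1 ≤ m := by omega
  have h5 : a * s ≤ a * (2 * m + 2) := Nat.mul_le_mul_left _ h3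
  have h6 : (4 * a + b + 1) * m ≤ m * m := Nat.mul_le_mul_right _ h4
  nlinarith [Nat.zero_le (a * m), Nat.zero_le (b * m), Nat.mul_le_mul_left a (show 1 ≤ m by omega),
    Nat.mul_le_mul_left b (show 1 ≤ m by omega)]

theorem natStr_pair_computable {α : Type*} [Primcodable α] {f g : α → ℕ}
    (hf : Primrec f) (hg : Primrec g) : Primrec (fun a => natStr (Nat.pair (f a) (g a))) :=
  natStr_primrec.comp (Primrec₂.natPair.comp hf hg)

theorem pairStr_primrec {α : Type*} [Primcodable α] {f g : α → BStr}
    (hf : Primrec f) (hg : Primrec g) : Primrec (fun a => pairStr (f a) (g a)) :=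
  natStr_primrec.comp (Primrec.encode.comp (Primrec.pair hf hg))

/-- Inverse of `pairStr`. -/
def unpairStr (s : BStr) : BStr × BStr :=
  ((Encodable.decode (natOf s) : Option (BStr × BStr))).getD ([], [])

theorem unpairStr_pairStr (x y : BStr) : unpairStr (pairStr x y) = (x, y) := by
  simp [unpairStr, pairStr, natOf_natStr, Encodable.encodek, -Encodable.encode_prod_val]

theorem unpairStr_primrec : Primrec unpairStr :=
  Primrec.option_getD.comp (Primrec.decode.comp natOf_primrec) (Primrec.const _)

/-- Shift of the second component of an encoded pair. -/
def shiftStr (i j : ℕ) (s : BStr) : BStr :=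
  natStr (Nat.pair (natOf s).unpair.1 ((natOf s).unpair.2 + i - j))

theorem shiftStr_apply (i j q l : ℕ) :
    shiftStr i j (natStr (Nat.pair q l)) = natStr (Nat.pair q (l + i - j)) := by
  simp [shiftStr, natOf_natStr]

theorem shiftStr_primrec (i j : ℕ) : Primrec (shiftStr i j) := by
  have hu : Primrec (fun s : BStr => (natOf s).unpair) := Primrec.unpair.comp natOf_primrec
  exact natStr_pair_computable (Primrec.fst.comp hu)
    (Primrec.nat_sub.comp (Primrec.nat_add.comp (Primrec.snd.comp hu) (Primrec.const i))
      (Primrec.const j))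

/-- Shift on encoded pairs `(T_l, a)`. -/
def shift2 (i j d e : ℕ) (s : BStr) : BStr :=
  pairStr (shiftStr i j (unpairStr s).1) (natStr (natOf (unpairStr s).2 + d - e))

theorem shift2_primrec (i j d e : ℕ) : Primrec (shift2 i j d e) :=
  pairStr_primrec ((shiftStr_primrec i j).comp (Primrec.fst.comp unpairStr_primrec))
    (natStr_primrec.comp (Primrec.nat_sub.comp (Primrec.nat_add.comp
      (natOf_primrec.comp (Primrec.snd.comp unpairStr_primrec)) (Primrec.const d))
      (Primrec.const e)))

theorem shift2_apply (i j d e q l a : ℕ) :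
    shift2 i j d e (pairStr (natStr (Nat.pair q l)) (natStr a)) =
      pairStr (natStr (Nat.pair q (l + i - j))) (natStr (a + d - e)) := by
  simp [shift2, unpairStr_pairStr, shiftStr_apply, natOf_natStr]

/-- The fixed-point lemma. There is a constant `c` such that for
all integers `n` and `q ≥ c` there is `l*` with `0 ≤ l* ≤ q − 1` and
`|β(l*) − l*| ≤ c`, where `T_l = (q, l)`, `α(l) = K(T_l | n)`, and
`β(l) = K(T_l, α(l) | q)`. -/
theorem fixed_point_index (U : UniversalPrefixDecompressor) :
    ∃ c : ℕ, ∀ n q : ℕ, c ≤ q →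
      ∃ l : ℕ, l ≤ q - 1 ∧
        K U (pairStr (natStr (Nat.pair q l))
            (natStr (K U (natStr (Nat.pair q l)) (natStr n)))) (natStr q) ≤ l + c ∧
        l ≤ K U (pairStr (natStr (Nat.pair q l))
            (natStr (K U (natStr (Nat.pair q l)) (natStr n)))) (natStr q) + c := by
  obtain ⟨cu, hcu⟩ := K_map U (shiftStr 1 0) (shiftStr_primrec 1 0).to_comp
  obtain ⟨cd, hcd⟩ := K_map U (shiftStr 0 1) (shiftStr_primrec 0 1).to_comp
  choose C hC using fun d => K_map U (shift2 0 1 d cu) (shift2_primrec 0 1 d cu).to_comp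
  obtain ⟨c2, hc2⟩ := K_log U (fun m => natStr (Nat.pair m (m - 1)))
    (natStr_pair_computable Primrec.id
      (Primrec.nat_sub.comp Primrec.id (Primrec.const 1))).to_comp
  obtain ⟨c3, hc3⟩ := K_log U
    (fun m => pairStr (natStr (Nat.pair m.unpair.1 (m.unpair.1 - 1))) (natStr m.unpair.2))
    (pairStr_primrec (natStr_pair_computable (Primrec.fst.comp Primrec.unpair)
      (Primrec.nat_sub.comp (Primrec.fst.comp Primrec.unpair) (Primrec.const 1)))
      (natStr_primrec.comp (Primrec.snd.comp Primrec.unpair))).to_comp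
  obtain ⟨N1, hN1⟩ := size_small 2 c2
  obtain ⟨N2, hN2⟩ := size_small 4 (c3 + 5)
  let S := ∑ d ∈ Finset.range (cu + cd + 1), C d
  refine ⟨N1 + N2 + S + 1, fun n q hq => ?_⟩
  let α : ℕ → ℕ := fun l => K U (natStr (Nat.pair q l)) (natStr n)
  let β : ℕ → ℕ := fun l => K U (pairStr (natStr (Nat.pair q l)) (natStr (α l))) (natStr q)
  show ∃ l, l ≤ q - 1 ∧ β l ≤ l + _ ∧ l ≤ β l + _
  have hup : ∀ l, α (l + 1) ≤ α l + cu := by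
    intro l
    have := hcu (natStr (Nat.pair q l)) (natStr n)
    rw [shiftStr_apply] at this
    exact this
  have hdown : ∀ l, α l ≤ α (l + 1) + cd := by
    intro l
    have := hcd (natStr (Nat.pair q (l + 1))) (natStr n)
    rw [shiftStr_apply] at this
    exact this
  have hβ : ∀ l, β l ≤ β (l + 1) + S := by
    intro l
    have h1 := hup l
    have h2 := hdown l
    obtain ⟨d, hd⟩ : ∃ d, d = α l + cu - α (l + 1) := ⟨_, rfl⟩
    have h3 := hC d (pairStr (natStr (Nat.pair q (l + 1))) (natStr (α (l + 1)))) (natStr q)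
    rw [shift2_apply, show α (l + 1) + d - cu = α l by omega,
      show l + 1 + 0 - 1 = l by omega] at h3
    have h4 : C d ≤ S := Finset.single_le_sum (f := C) (fun _ _ => Nat.zero_le _)
      (Finset.mem_range.2 (by omega))
    exact h3.trans (Nat.add_le_add_left h4 _)
  have hα1 : α (q - 1) ≤ q := (hc2 q (natStr n)).trans (hN1 q (by omega))
  have hend : β (q - 1) ≤ q - 1 := by
    have h1 := hc3 (Nat.pair q (α (q - 1))) (natStr q)
    simp only [Nat.unpair_pair] at h1
    have h2 : Nat.size (Nat.pair q (α (q - 1))) ≤ 2 * Nat.size q + 2 := by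
      rw [Nat.size_le]
      have h3 : Nat.pair q (α (q - 1)) < (max q (α (q - 1)) + 1) ^ 2 :=
        Nat.pair_lt_max_add_one_sq _ _
      rw [max_eq_left hα1] at h3
      have h4 : q < 2 ^ Nat.size q := Nat.lt_size_self q
      calc _ < (q + 1) ^ 2 := h3
        _ ≤ (2 ^ Nat.size q) ^ 2 := Nat.pow_le_pow_left h4 2
        _ = 2 ^ (2 * Nat.size q) := by rw [← pow_mul, mul_comm]
        _ ≤ _ := Nat.pow_le_pow_right (by norm_num) (by omega)
    have h5 := hN2 q (by omega)
    have h6 : β (q - 1) ≤ 2 * Nat.size (Nat.pair q (α (q - 1))) + c3 := h1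
    omega
  have hex : ∃ l, β l ≤ l := ⟨_, hend⟩
  have hl := Nat.find_spec hex
  have hmin : Nat.find hex ≤ q - 1 := Nat.find_min' hex hend
  refine ⟨Nat.find hex, hmin, by omega, ?_⟩
  rcases hcase : Nat.find hex with _ | k
  · omega
  · have h1 : ¬ β k ≤ k := Nat.find_min hex (by omega)
    have h2 := hβ k
    omega
end

section
/- For every constant c₀ there exists a constant c such that the following holds for all integers n, q, all strings q̃, and all strings x: if K(n | q) ≤ c₀, C_V(q | q̃) ≤ c₀, and, writing α = K(q̃ | n), |K(q̃ | n) − K(q̃, α, K(q̃, α | q) | n)| ≤ c₀, then |(K(x, q̃, α | q) − K(q̃, α | q)) − (K(q̃, x | n) − K(q̃ | n))| ≤ c (the complexity symmetry shift). -/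
open scoped Classical ENNReal

/-! ### Basic computability -/

namespace KShift

/-- Value of a string of bits, least significant first. -/
def ofB (p : BStr) : ℕ := p.foldr (fun b n => Nat.bit b n) 0

theorem ofB_natStr (n : ℕ) : ofB (natStr n) = n := by
  unfold ofB natStr
  induction n using Nat.binaryRec' with
  | zero => simp
  | bit b n h ih => rw [Nat.bits_append_bit n b h]; simp [ih]

theorem bit_primrec : Primrec₂ (fun (b : Bool) (n : ℕ) => Nat.bit b n) := by
  have h : Primrec (fun q : Bool × ℕ => bif q.1 then 2 * q.2 + 1 else 2 * q.2) :=
    Primrec.cond Primrec.fst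
      (Primrec.succ.comp (Primrec.nat_mul.comp (Primrec.const 2) Primrec.snd))
      (Primrec.nat_mul.comp (Primrec.const 2) Primrec.snd)
  exact Primrec.of_eq h (fun q => by rcases q with ⟨b, n⟩; cases b <;> simp [Nat.bit])

theorem ofB_primrec : Primrec ofB := by
  have := Primrec.list_foldr (α := BStr) (f := fun p => p) (g := fun _ => 0)
    (h := fun _ (q : Bool × ℕ) => Nat.bit q.1 q.2) Primrec.id (Primrec.const 0)
    (bit_primrec.comp (Primrec.fst.comp Primrec.snd) (Primrec.snd.comp Primrec.snd))
  exact this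

theorem natStr_primrec : Primrec natStr := by
  have h : Primrec₂ (fun (_ : Unit) (n : ℕ) => natStr n) := by
    refine Primrec.nat_strong_rec (fun (_ : Unit) (n : ℕ) => natStr n)
      (g := fun _ l => if l.length = 0 then some [] else
        (l[l.length / 2]?).map (fun t => Nat.bodd l.length :: t)) ?_ ?_
    · have hl : Primrec (fun q : Unit × List BStr => q.2.length) :=
        Primrec.list_length.comp Primrec.snd
      refine Primrec.ite (Primrec.eq.comp hl (Primrec.const 0)) (Primrec.const _) ?_
      refine Primrec.option_map (Primrec.list_getElem?.comp Primrec.snd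
        (Primrec.nat_div.comp hl (Primrec.const 2))) ?_
      exact Primrec.list_cons.comp (Primrec.nat_bodd.comp (hl.comp Primrec.fst)) Primrec.snd
    · intro _ n
      rcases Nat.eq_zero_or_pos n with rfl | hn
      · simp [natStr]
      · have h2 : n / 2 < n := Nat.div_lt_self hn (by norm_num)
        have h3 : Nat.bits n = n.bodd :: Nat.bits (n / 2) := by
          conv_lhs => rw [← Nat.bit_bodd_div2 n]
          rw [Nat.bits_append_bit, Nat.div2_val]
          intro h0
          have := Nat.bit_bodd_div2 n
          rw [h0] at this
          cases hb : n.bodd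
          · rw [hb] at this; simp at this; omega
          · rfl
        simp [hn.ne', natStr, h3, h2]
  exact h.comp (Primrec.const ()) Primrec.id

theorem pairStr_primrec : Primrec₂ pairStr :=
  natStr_primrec.comp (Primrec.encode.comp (Primrec.pair Primrec.fst Primrec.snd))

theorem tripStr_primrec : Primrec (fun q : BStr × BStr × BStr => tripStr q.1 q.2.1 q.2.2) :=
  natStr_primrec.comp Primrec.encode

theorem pair_comp {α : Type*} [Primcodable α] {f g : α → BStr} (hf : Computable f)
    (hg : Computable g) : Computable (fun a => pairStr (f a) (g a)) :=
  Computable₂.comp pairStr_primrec.to_comp hf hg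

theorem trip_comp {α : Type*} [Primcodable α] {f g h : α → BStr} (hf : Computable f)
    (hg : Computable g) (hh : Computable h) : Computable (fun a => tripStr (f a) (g a) (h a)) :=
  Computable.comp (g := fun a => (f a, g a, h a)) tripStr_primrec.to_comp
    (Computable.pair hf (Computable.pair hg hh))

/-- Decoder of pairs. -/
def unP (s : BStr) : BStr × BStr := (Encodable.decode (α := BStr × BStr) (ofB s)).getD ([], [])

/-- Decoder of triples. -/
def unT (s : BStr) : BStr × BStr × BStr :=
  (Encodable.decode (α := BStr × BStr × BStr) (ofB s)).getD ([], [], [])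

@[simp] theorem unP_pairStr (x y : BStr) : unP (pairStr x y) = (x, y) := by
  unfold unP pairStr; rw [ofB_natStr, Encodable.encodek]; rfl

@[simp] theorem unT_tripStr (x y z : BStr) : unT (tripStr x y z) = (x, y, z) := by
  unfold unT tripStr; rw [ofB_natStr, Encodable.encodek]; rfl

theorem unP_primrec : Primrec unP :=
  Primrec.option_getD.comp (Primrec.decode.comp ofB_primrec) (Primrec.const _)

theorem unT_primrec : Primrec unT :=
  Primrec.option_getD.comp (Primrec.decode.comp ofB_primrec) (Primrec.const _)

theorem pow2_primrec : Primrec (fun n : ℕ => 2 ^ n) := by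
  have h : Primrec (fun n : ℕ => Nat.rec (motive := fun _ => ℕ) 1 (fun _ IH => 2 * IH) n) :=
    Primrec.nat_rec₁ 1 (Primrec.nat_mul.comp (Primrec.const 2) Primrec.snd)
  refine Primrec.of_eq h (fun n => ?_)
  induction n with
  | zero => rfl
  | succ n ih => simp only [ih]; ring

/-- Value of a string of bits, most significant first. -/
def valB (p : BStr) : ℕ := p.foldl (fun a b => Nat.bit b a) 0

theorem valB_primrec : Primrec valB :=
  Primrec.list_foldl (α := BStr) (f := fun p => p) (g := fun _ => 0)
    (h := fun _ (q : ℕ × Bool) => Nat.bit q.2 q.1) Primrec.id (Primrec.const 0)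
    (bit_primrec.comp (Primrec.snd.comp Primrec.snd) (Primrec.fst.comp Primrec.snd))

theorem valB_concat (p : BStr) (b : Bool) : valB (p ++ [b]) = Nat.bit b (valB p) := by
  simp [valB]

theorem valB_lt (p : BStr) : valB p < 2 ^ p.length := by
  induction p using List.reverseRecOn with
  | nil => simp [valB]
  | append_singleton p b ih =>
    rw [valB_concat, List.length_append, List.length_singleton, pow_succ]
    cases b <;> simp [Nat.bit] <;> omega

theorem exists_valB (L : ℕ) : ∀ m : ℕ, m < 2 ^ L → ∃ p : BStr, p.length = L ∧ valB p = m := by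
  induction L with
  | zero => intro m hm; exact ⟨[], rfl, by simp [valB] at *; omega⟩
  | succ L ih =>
    intro m hm
    obtain ⟨p, hp, hv⟩ := ih (m / 2) (by rw [pow_succ] at hm; omega)
    refine ⟨p ++ [m.bodd], by simp [hp], ?_⟩
    rw [valB_concat, hv, ← Nat.div2_val, Nat.bit_bodd_div2]

/-- lower end of the dyadic interval of `p`. -/
noncomputable def lo (p : BStr) : ℝ := valB p / 2 ^ p.length
/-- upper end of the dyadic interval of `p`. -/
noncomputable def hi (p : BStr) : ℝ := (valB p + 1) / 2 ^ p.length

theorem lo_lt_hi (p : BStr) : lo p < hi p := by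
  unfold lo hi; gcongr; linarith

theorem concat_lo_hi (p : BStr) (b : Bool) : lo p ≤ lo (p ++ [b]) ∧ hi (p ++ [b]) ≤ hi p := by
  have hp : (0 : ℝ) < 2 ^ p.length := by positivity
  constructor
  · unfold lo
    rw [valB_concat, List.length_append, List.length_singleton, pow_succ,
      div_le_div_iff₀ (by positivity) (by positivity)]
    have : (2 * valB p : ℝ) ≤ (Nat.bit b (valB p) : ℕ) := by
      cases b <;> simp [Nat.bit]
    nlinarith
  · unfold hi
    rw [valB_concat, List.length_append, List.length_singleton, pow_succ,
      div_le_div_iff₀ (by positivity) (by positivity)]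
    have : ((Nat.bit b (valB p) : ℕ) : ℝ) ≤ 2 * valB p + 1 := by
      cases b <;> simp [Nat.bit]
    nlinarith

theorem prefix_lo_hi (p r : BStr) : lo p ≤ lo (p ++ r) ∧ hi (p ++ r) ≤ hi p := by
  induction r using List.reverseRecOn with
  | nil => simp
  | append_singleton r b ih =>
    rw [← List.append_assoc]
    have h := concat_lo_hi (p ++ r) b
    exact ⟨ih.1.trans h.1, h.2.trans ih.2⟩

/-! ### Request sequences and the Kraft-Chaitin theorem -/

/-- The weight of a request. -/
noncomputable def wo (o : Option (BStr × ℕ)) : ℝ≥0∞ := o.elim 0 (fun v => 2⁻¹ ^ v.2)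

@[simp] theorem wo_none : wo none = 0 := rfl
@[simp] theorem wo_some (v : BStr × ℕ) : wo (some v) = 2⁻¹ ^ v.2 := rfl

/-- Add a request to a dyadic sum `s.1 / 2 ^ s.2`. -/
def stepS (o : Option (BStr × ℕ)) (s : ℕ × ℕ) : ℕ × ℕ :=
  (o.map (fun v => (s.1 * 2 ^ v.2 + 2 ^ s.2, s.2 + v.2))).getD s

theorem stepS_primrec : Primrec₂ stepS := by
  refine Primrec.option_getD.comp (Primrec.option_map Primrec.fst ?_) Primrec.snd
  have hl : Primrec (fun q : (Option (BStr × ℕ) × (ℕ × ℕ)) × (BStr × ℕ) => q.2.2) :=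
    Primrec.snd.comp Primrec.snd
  have h1 : Primrec (fun q : (Option (BStr × ℕ) × (ℕ × ℕ)) × (BStr × ℕ) => q.1.2.1) :=
    Primrec.fst.comp (Primrec.snd.comp Primrec.fst)
  have h2 : Primrec (fun q : (Option (BStr × ℕ) × (ℕ × ℕ)) × (BStr × ℕ) => q.1.2.2) :=
    Primrec.snd.comp (Primrec.snd.comp Primrec.fst)
  exact Primrec.pair (Primrec.nat_add.comp (Primrec.nat_mul.comp h1 (pow2_primrec.comp hl))
    (pow2_primrec.comp h2)) (Primrec.nat_add.comp h2 hl)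

/-- Dyadic representation of partial sums. -/
def st (f : ℕ → Option (BStr × ℕ)) (t : ℕ) : ℕ × ℕ :=
  Nat.rec (motive := fun _ => ℕ × ℕ) (0, 0) (fun t IH => stepS (f t) IH) t

theorem st_computable {α : Type*} [Primcodable α] {e : α → ℕ → Option (BStr × ℕ)}
    (he : Computable₂ e) : Computable₂ (fun a t => st (e a) t) := by
  have := Computable.nat_rec (α := α × ℕ) (σ := ℕ × ℕ) (f := fun q => q.2) (g := fun _ => (0, 0))
    (h := fun q r => stepS (e q.1 r.1) r.2) Computable.snd (Computable.const _)
    (stepS_primrec.to_comp.comp (he.comp (Computable.fst.comp Computable.fst)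
      (Computable.fst.comp Computable.snd)) (Computable.snd.comp Computable.snd))
  exact this

/-- Partial sums as reals. -/
noncomputable def pos (f : ℕ → Option (BStr × ℕ)) (t : ℕ) : ℝ := (st f t).1 / 2 ^ (st f t).2

theorem pos_succ_none {f : ℕ → Option (BStr × ℕ)} {t : ℕ} (h : f t = none) :
    pos f (t + 1) = pos f t := by
  have : st f (t + 1) = stepS (f t) (st f t) := rfl
  simp [pos, this, h, stepS]

theorem pos_succ_some {f : ℕ → Option (BStr × ℕ)} {t : ℕ} {v : BStr × ℕ} (h : f t = some v) :
    pos f (t + 1) = pos f t + 1 / 2 ^ v.2 := by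
  have : st f (t + 1) = stepS (f t) (st f t) := rfl
  simp only [pos, this, h, stepS]
  simp only [Option.map_some, Option.getD_some]
  push_cast
  rw [pow_add]
  field_simp

theorem pos_zero (f : ℕ → Option (BStr × ℕ)) : pos f 0 = 0 := by simp [pos, st]

theorem pos_nonneg (f : ℕ → Option (BStr × ℕ)) (t : ℕ) : 0 ≤ pos f t := by
  unfold pos; positivity

theorem pos_mono (f : ℕ → Option (BStr × ℕ)) : Monotone (pos f) := by
  refine monotone_nat_of_le_succ (fun t => ?_)
  cases h : f t with
  | none => rw [pos_succ_none h]
  | some v =>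
    rw [pos_succ_some h]
    have : (0 : ℝ) ≤ 1 / 2 ^ v.2 := by positivity
    linarith

theorem ofReal_inv_pow (l : ℕ) : ENNReal.ofReal (1 / 2 ^ l) = 2⁻¹ ^ l := by
  rw [one_div, ENNReal.ofReal_inv_of_pos (by positivity), ENNReal.ofReal_pow (by norm_num),
    ENNReal.inv_pow]
  norm_num

theorem ofReal_pos (f : ℕ → Option (BStr × ℕ)) (T : ℕ) :
    ENNReal.ofReal (pos f T) = ∑ t ∈ Finset.range T, wo (f t) := by
  induction T with
  | zero => simp [pos_zero]
  | succ T ih =>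
    rw [Finset.sum_range_succ, ← ih]
    cases h : f T with
    | none => simp [pos_succ_none h]
    | some v =>
      rw [pos_succ_some h, ENNReal.ofReal_add (pos_nonneg _ _) (by positivity), ofReal_inv_pow]
      simp

theorem ofReal_pos_le (f : ℕ → Option (BStr × ℕ)) (T : ℕ) :
    ENNReal.ofReal (pos f T) ≤ ∑' t, wo (f t) := by
  rw [ofReal_pos]; exact ENNReal.sum_le_tsum _

/-- Is the interval of `p` inside the interval of the request? -/
def accO (o : Option (BStr × ℕ)) (s : ℕ × ℕ) (p : BStr) : Option BStr :=
  o.bind (fun v => if (p.length = v.2 + 1 ∧ s.1 * 2 ^ (v.2 + 1) ≤ valB p * 2 ^ s.2) ∧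
      (valB p + 1) * 2 ^ s.2 ≤ s.1 * 2 ^ (v.2 + 1) + 2 * 2 ^ s.2 then some v.1 else none)

theorem accO_primrec :
    Primrec (fun q : (Option (BStr × ℕ)) × (ℕ × ℕ) × BStr => accO q.1 q.2.1 q.2.2) := by
  let T := ((Option (BStr × ℕ)) × (ℕ × ℕ) × BStr) × (BStr × ℕ)
  have hl : Primrec (fun q : T => q.2.2 + 1) := Primrec.succ.comp (Primrec.snd.comp Primrec.snd)
  have h1 : Primrec (fun q : T => q.1.2.1.1) :=
    Primrec.fst.comp (Primrec.fst.comp (Primrec.snd.comp Primrec.fst))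
  have h2 : Primrec (fun q : T => 2 ^ q.1.2.1.2) :=
    pow2_primrec.comp (Primrec.snd.comp (Primrec.fst.comp (Primrec.snd.comp Primrec.fst)))
  have hp : Primrec (fun q : T => q.1.2.2) :=
    Primrec.snd.comp (Primrec.snd.comp Primrec.fst)
  have hv : Primrec (fun q : T => valB q.1.2.2) := valB_primrec.comp hp
  have hm : Primrec (fun q : T => q.1.2.1.1 * 2 ^ (q.2.2 + 1)) :=
    Primrec.nat_mul.comp h1 (pow2_primrec.comp hl)
  refine Primrec.option_bind Primrec.fst ?_
  refine Primrec.ite (PrimrecPred.and (PrimrecPred.and ?_ ?_) ?_)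
    (Primrec.option_some.comp (Primrec.fst.comp Primrec.snd)) (Primrec.const _)
  · exact Primrec.eq.comp (Primrec.list_length.comp hp) hl
  · exact Primrec.nat_le.comp hm (Primrec.nat_mul.comp hv h2)
  · exact Primrec.nat_le.comp (Primrec.nat_mul.comp (Primrec.succ.comp hv) h2)
      (Primrec.nat_add.comp hm (Primrec.nat_mul.comp (Primrec.const 2) h2))

theorem accO_iff (f : ℕ → Option (BStr × ℕ)) (t : ℕ) (p x : BStr) :
    accO (f t) (st f t) p = some x ↔
      ∃ l, f t = some (x, l) ∧ p.length = l + 1 ∧ pos f t ≤ lo p ∧ hi p ≤ pos f (t + 1) := by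
  cases h : f t with
  | none => simp [accO]
  | some v =>
    obtain ⟨y, l⟩ := v
    have key : p.length = l + 1 →
        (((st f t).1 * 2 ^ (l + 1) ≤ valB p * 2 ^ (st f t).2 ↔ pos f t ≤ lo p) ∧
        ((valB p + 1) * 2 ^ (st f t).2 ≤ (st f t).1 * 2 ^ (l + 1) + 2 * 2 ^ (st f t).2 ↔
          hi p ≤ pos f (t + 1))) := by
      intro hp
      rw [pos_succ_some h]
      simp only [pos, lo, hi, hp]
      constructor
      · rw [div_le_div_iff₀ (by positivity) (by positivity)]
        exact_mod_cast Iff.rfl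
      · rw [div_add_div _ _ (by positivity) (by positivity),
          div_le_div_iff₀ (by positivity) (by positivity)]
        have hL : (0 : ℝ) < 2 ^ l := by positivity
        rw [← Nat.cast_le (α := ℝ)]
        push_cast
        rw [← mul_le_mul_iff_left₀ hL]
        ring_nf
    simp only [accO, Option.bind_some]
    constructor
    · intro hh
      split_ifs at hh with hc
      simp only [Option.some.injEq] at hh
      subst hh
      have := key hc.1.1
      exact ⟨l, rfl, hc.1.1, this.1.1 hc.1.2, this.2.1 hc.2⟩
    · rintro ⟨l', hl', hp, h1, h2⟩
      simp only [Option.some.injEq, Prod.mk.injEq] at hl'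
      obtain ⟨rfl, rfl⟩ := hl'
      have := key hp
      rw [if_pos ⟨⟨hp, this.1.2 h1⟩, this.2.2 h2⟩]

theorem acc_unique (f : ℕ → Option (BStr × ℕ)) {t t' : ℕ} {p p' x x' : BStr}
    (h : accO (f t) (st f t) p = some x) (h' : accO (f t') (st f t') p' = some x')
    (hp : p <+: p') : t = t' ∧ p = p' := by
  obtain ⟨l, hf, hl, h1, h2⟩ := (accO_iff f t p x).1 h
  obtain ⟨l', hf', hl', h1', h2'⟩ := (accO_iff f t' p' x').1 h'
  obtain ⟨r, rfl⟩ := hp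
  have hr := prefix_lo_hi p r
  have hlt := lo_lt_hi (p ++ r)
  rcases lt_trichotomy t t' with hlt' | heq | hgt
  · have := pos_mono f (show t + 1 ≤ t' from hlt')
    linarith
  · subst heq
    refine ⟨rfl, ?_⟩
    rw [hf] at hf'
    simp only [Option.some.injEq, Prod.mk.injEq] at hf'
    apply List.IsPrefix.eq_of_length ⟨r, rfl⟩
    rw [hl, hl', hf'.2]
  · have := pos_mono f (show t' + 1 ≤ t from hgt)
    linarith

theorem acc_exists (f : ℕ → Option (BStr × ℕ)) {t l : ℕ} {x : BStr} (h : f t = some (x, l))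
    (h1 : pos f (t + 1) ≤ 1) : ∃ p : BStr, p.length = l + 1 ∧ accO (f t) (st f t) p = some x := by
  have hs := pos_succ_some h
  simp only at hs
  have hL : (0 : ℝ) < 2 ^ (l + 1) := by positivity
  have h2 : (1 : ℝ) / 2 ^ l = 2 / 2 ^ (l + 1) := by rw [pow_succ]; field_simp
  set m := ⌈pos f t * 2 ^ (l + 1)⌉₊ with hm
  have hm1 : pos f t * 2 ^ (l + 1) ≤ m := Nat.le_ceil _
  have hm2 : (m : ℝ) < pos f t * 2 ^ (l + 1) + 1 :=
    Nat.ceil_lt_add_one (mul_nonneg (pos_nonneg _ _) hL.le)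
  have hu : ((m : ℝ) + 1) / 2 ^ (l + 1) ≤ pos f (t + 1) := by
    rw [hs, h2, div_le_iff₀ hL, add_mul, div_mul_cancel₀ _ hL.ne']
    linarith
  have hml : m < 2 ^ (l + 1) := by
    have := hu.trans h1
    rw [div_le_one hL] at this
    have h3 : ((m + 1 : ℕ) : ℝ) ≤ ((2 ^ (l + 1) : ℕ) : ℝ) := by push_cast; exact this
    exact Nat.cast_le.1 h3
  obtain ⟨p, hp, hv⟩ := exists_valB (l + 1) m hml
  refine ⟨p, hp, (accO_iff f t p x).2 ⟨l, h, hp, ?_, ?_⟩⟩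
  · rw [lo, hp, hv, le_div_iff₀ hL]; exact hm1
  · rw [hi, hp, hv]; exact hu

theorem K_spec (U : UniversalPrefixDecompressor) (x y : BStr) :
    ∃ p : BStr, p.length = K U x y ∧ x ∈ U.D p y := by
  have : (K U x y) ∈ {n | ∃ p : BStr, p.length = n ∧ x ∈ U.D p y} := by
    apply Nat.sInf_mem
    obtain ⟨p, hp⟩ := U.onto x y
    exact ⟨p.length, p, rfl, hp⟩
  exact this

theorem condC_le (D : BStr → BStr →. BStr) {x y p : BStr} (h : x ∈ D p y) :
    condC D x y ≤ p.length := Nat.sInf_le ⟨p, rfl, h⟩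

/-- Kraft-Chaitin for computable sequences of requests. -/
theorem KC_enum (U : UniversalPrefixDecompressor) (e : BStr → ℕ → Option (BStr × ℕ))
    (he : Computable₂ e) : ∃ c : ℕ, ∀ z, ∑' t, wo (e z t) ≤ 1 →
      ∀ t x l, e z t = some (x, l) → K U x z ≤ l + c := by
  let D : BStr → BStr →. BStr := fun p z =>
    Nat.rfindOpt (fun t => accO (e z t) (st (e z) t) p)
  have hD : Partrec₂ D := by
    have hz : Computable (fun q : (BStr × BStr) × ℕ => q.1.2) :=
      Computable.snd.comp Computable.fst
    have := Partrec.rfindOpt (α := BStr × BStr)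
      (f := fun q t => accO (e q.2 t) (st (e q.2) t) q.1)
      (accO_primrec.to_comp.comp (Computable.pair (he.comp hz Computable.snd)
        (Computable.pair ((st_computable he).comp hz Computable.snd)
          (Computable.fst.comp Computable.fst))))
    exact this
  have hpf : PrefixFreeDom D := by
    intro y p q hp hq hpq
    obtain ⟨t, a, ha⟩ := Nat.rfindOpt_dom.1 hp
    obtain ⟨t', a', ha'⟩ := Nat.rfindOpt_dom.1 hq
    exact (acc_unique (e y) ha ha' hpq).2
  obtain ⟨c, hc⟩ := U.universal D hD hpf
  refine ⟨c + 1, fun z hz t x l hx => ?_⟩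
  have hpos : pos (e z) (t + 1) ≤ 1 := by
    have := (ofReal_pos_le (e z) (t + 1)).trans hz
    exact ENNReal.ofReal_le_one.1 this
  obtain ⟨p, hp, hacc⟩ := acc_exists (e z) hx hpos
  have hmem : x ∈ D p z := by
    have hdom : (D p z).Dom := Nat.rfindOpt_dom.2 ⟨t, x, hacc⟩
    obtain ⟨t', ht'⟩ := Nat.rfindOpt_spec (Part.get_mem hdom)
    have := (acc_unique (e z) hacc ht' (List.prefix_refl p)).1
    subst this
    have h2 := Option.some.inj (hacc.symm.trans ht')
    rw [h2]
    exact Part.get_mem hdom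
  have h1 := hc x z ⟨p, hmem⟩
  have h2 := condC_le D hmem
  unfold K
  omega

/-! ### Enumeration of partial recursive requests -/

theorem approx {α σ : Type*} [Primcodable α] [Primcodable σ] {f : α →. σ} (hf : Partrec f) :
    ∃ g : α → ℕ → Option σ, Computable₂ g ∧ (∀ a s s' v, s ≤ s' → g a s = some v → g a s' = some v) ∧
      (∀ a, g a 0 = none) ∧ ∀ a v, v ∈ f a ↔ ∃ s, g a s = some v := by
  obtain ⟨c, hc⟩ := Nat.Partrec.Code.exists_code.1 hf
  have hev : ∀ a : α, Nat.Partrec.Code.eval c (Encodable.encode a) = (f a).map Encodable.encode := by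
    intro a; rw [hc]; simp
  refine ⟨fun a s => (Nat.Partrec.Code.evaln s c (Encodable.encode a)).bind
    (Encodable.decode (α := σ)), ?_, ?_, ?_, ?_⟩
  · refine Computable.option_bind ?_ (Computable.decode.comp Computable.snd)
    exact Nat.Partrec.Code.primrec_evaln.to_comp.comp
      (Computable.pair (Computable.pair Computable.snd (Computable.const c))
        (Computable.encode.comp Computable.fst))
  · intro a s s' v hs h
    obtain ⟨n, hn, hd⟩ := Option.bind_eq_some_iff.1 h
    exact Option.bind_eq_some_iff.2 ⟨n, Nat.Partrec.Code.evaln_mono hs hn, hd⟩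
  · intro a
    simp [Nat.Partrec.Code.evaln]
  · intro a v
    constructor
    · intro hv
      have : Encodable.encode v ∈ Nat.Partrec.Code.eval c (Encodable.encode a) := by
        rw [hev]; exact Part.mem_map _ hv
      obtain ⟨s, hs⟩ := Nat.Partrec.Code.evaln_complete.1 this
      exact ⟨s, Option.bind_eq_some_iff.2 ⟨_, hs, Encodable.encodek v⟩⟩
    · rintro ⟨s, hs⟩
      obtain ⟨n, hn, hd⟩ := Option.bind_eq_some_iff.1 hs
      have := Nat.Partrec.Code.evaln_sound hn
      rw [hev] at this
      obtain ⟨w, hw, rfl⟩ := (Part.mem_map_iff _).1 this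
      rw [Encodable.encodek] at hd
      cases hd
      exact hw

/-- The weight of a partial request. -/
noncomputable def wp (o : Part (BStr × ℕ)) : ℝ≥0∞ :=
  if h : o.Dom then 2⁻¹ ^ (o.get h).2 else 0

theorem wp_mem {o : Part (BStr × ℕ)} {v : BStr × ℕ} (h : v ∈ o) : wp o = 2⁻¹ ^ v.2 := by
  obtain ⟨hd, rfl⟩ := h
  simp [wp, hd]

theorem wp_le {o : Part (BStr × ℕ)} {b : ℝ≥0∞} (h : ∀ v ∈ o, 2⁻¹ ^ v.2 ≤ b) : wp o ≤ b := by
  unfold wp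
  split_ifs with hd
  · exact h _ (Part.get_mem hd)
  · exact zero_le

theorem enum_exists {W : Type*} [Primcodable W] {F : BStr → W →. BStr × ℕ} (hF : Partrec₂ F) :
    ∃ e : BStr → ℕ → Option (BStr × ℕ), Computable₂ e ∧
      (∀ z, ∑' t, wo (e z t) ≤ ∑' w, wp (F z w)) ∧
      ∀ z w v, v ∈ F z w → ∃ t, e z t = some v := by
  obtain ⟨g, hg, gmono, g0, gspec⟩ := approx (f := fun q : BStr × W => F q.1 q.2) hF
  let e : BStr → ℕ → Option (BStr × ℕ) := fun z t =>
    (Encodable.decode₂ W t.unpair.1).bind (fun w =>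
      bif (g (z, w) t.unpair.2).isSome then none else g (z, w) (t.unpair.2 + 1))
  have espec : ∀ z t v, e z t = some v ↔ ∃ w, Encodable.decode₂ W t.unpair.1 = some w ∧
      g (z, w) t.unpair.2 = none ∧ g (z, w) (t.unpair.2 + 1) = some v := by
    intro z t v
    simp only [e, Option.bind_eq_some_iff]
    refine exists_congr (fun w => and_congr_right (fun _ => ?_))
    cases g (z, w) t.unpair.2 <;> simp
  refine ⟨e, ?_, ?_, ?_⟩
  · have hu1 : Computable (fun q : BStr × ℕ => q.2.unpair.1) :=
      Computable.fst.comp (Computable.unpair.comp Computable.snd)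
    have hu2 : Computable (fun q : (BStr × ℕ) × W => q.1.2.unpair.2) :=
      Computable.snd.comp (Computable.unpair.comp (Computable.snd.comp Computable.fst))
    have hzw : Computable (fun q : (BStr × ℕ) × W => (q.1.1, q.2)) :=
      Computable.pair (Computable.fst.comp Computable.fst) Computable.snd
    refine Computable.option_bind (Primrec.decode₂.to_comp.comp hu1) ?_
    exact Computable.cond (Primrec.option_isSome.to_comp.comp (hg.comp hzw hu2))
      (Computable.const _) (hg.comp hzw (Computable.succ.comp hu2))
  · intro z
    let T := {t : ℕ | e z t ≠ none}
    have hT : ∀ t : T, ∃ w v, e z t = some v ∧ Encodable.decode₂ W (t : ℕ).unpair.1 = some w ∧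
        g (z, w) (t : ℕ).unpair.2 = none ∧ g (z, w) ((t : ℕ).unpair.2 + 1) = some v := by
      rintro ⟨t, ht⟩
      obtain ⟨v, hv⟩ := Option.ne_none_iff_exists'.1 ht
      obtain ⟨w, hw⟩ := (espec z t v).1 hv
      exact ⟨w, v, hv, hw⟩
    choose φ ν h1 h2 h3 h4 using hT
    -- sum over the support
    have hsum : ∑' t, wo (e z t) = ∑' t : T, wo (e z t) := by
      symm
      apply tsum_subtype_eq_of_support_subset (f := fun t => wo (e z t)) (s := T)
      intro t ht
      simp only [Function.mem_support] at ht
      intro h0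
      rw [h0] at ht
      exact ht rfl
    rw [hsum]
    have hinj : Function.Injective φ := by
      have key : ∀ a b : T, φ a = φ b → (a : ℕ).unpair.2 ≤ (b : ℕ).unpair.2 := by
        intro a b hab
        by_contra hlt
        have h5 := gmono _ _ (a : ℕ).unpair.2 _ (by omega) (h4 b)
        rw [← hab, h3 a] at h5
        cases h5
      intro a b hab
      have e1 := Encodable.mem_decode₂.1 (h2 a)
      have e2 := Encodable.mem_decode₂.1 (h2 b)
      have e3 : (a : ℕ).unpair.2 = (b : ℕ).unpair.2 := le_antisymm (key a b hab) (key b a hab.symm)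
      apply Subtype.ext
      rw [← Nat.pair_unpair (a : ℕ), ← Nat.pair_unpair (b : ℕ), ← e1, ← e2, e3, hab]
    have hval : ∀ t : T, wo (e z t) = wp (F z (φ t)) := by
      intro t
      have : ν t ∈ F z (φ t) := (gspec (z, φ t) (ν t)).2 ⟨_, h4 t⟩
      rw [wp_mem this, h1 t, wo_some]
    rw [tsum_congr hval]
    exact ENNReal.tsum_comp_le_tsum_of_injective (f := φ) hinj (fun w => wp (F z w))
  · intro z w v hv
    have hex := (gspec (z, w) v).1 hv
    have hs := Nat.find_spec hex
    set s := Nat.find hex with hsdef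
    have hs0 : s ≠ 0 := by intro h; rw [h, g0] at hs; cases hs
    obtain ⟨s', hs'⟩ := Nat.exists_eq_succ_of_ne_zero hs0
    refine ⟨Nat.pair (Encodable.encode w) s', (espec z _ v).2 ⟨w, by simp, ?_, ?_⟩⟩
    · simp only [Nat.unpair_pair]
      cases hn : g (z, w) s' with
      | none => rfl
      | some v' =>
        have := gmono _ _ s v' (by omega) hn
        rw [hs] at this
        have h3 := Nat.find_min' hex (this ▸ hn)
        omega
    · simp only [Nat.unpair_pair]
      rw [← hs, hs']

theorem KC_part (U : UniversalPrefixDecompressor) {W : Type*} [Primcodable W]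
    {F : BStr → W →. BStr × ℕ} (hF : Partrec₂ F) :
    ∃ c : ℕ, ∀ z, ∑' w, wp (F z w) ≤ 1 → ∀ w x l, (x, l) ∈ F z w → K U x z ≤ l + c := by
  obtain ⟨e, he, hs, hm⟩ := enum_exists hF
  obtain ⟨c, hc⟩ := KC_enum U e he
  refine ⟨c, fun z hz w x l h => ?_⟩
  obtain ⟨t, ht⟩ := hm z w _ h
  exact hc z ((hs z).trans hz) t x l ht

/-- Kraft's inequality. -/
theorem kraft_finset (S : Finset BStr)
    (hS : ∀ p ∈ S, ∀ q ∈ S, p <+: q → p = q) : ∑ p ∈ S, (1 / 2 : ℝ) ^ p.length ≤ 1 := by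
  by_cases h0 : ([] : BStr) ∈ S
  · have : S = {[]} := by
      ext q
      simp only [Finset.mem_singleton]
      constructor
      · intro hq; exact (hS _ h0 q hq ⟨q, rfl⟩).symm
      · rintro rfl; exact h0
    rw [this]; simp
  · have hud : InformationTheory.UniquelyDecodable (S : Set BStr) := by
      intro L₁
      induction L₁ with
      | nil =>
        intro L₂ _ h2 hf
        cases L₂ with
        | nil => rfl
        | cons b L₂ =>
          exfalso
          simp only [List.flatten_nil, List.flatten_cons] at hf
          have hb : b = [] := (List.append_eq_nil_iff.1 hf.symm).1
          exact h0 (hb ▸ h2 b (by simp))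
      | cons a L₁ ih =>
        intro L₂ h1 h2 hf
        cases L₂ with
        | nil =>
          exfalso
          simp only [List.flatten_nil, List.flatten_cons] at hf
          have hb : a = [] := (List.append_eq_nil_iff.1 hf).1
          exact h0 (hb ▸ h1 a (by simp))
        | cons b L₂ =>
          simp only [List.flatten_cons] at hf
          have ha : a ∈ S := h1 a (by simp)
          have hb : b ∈ S := h2 b (by simp)
          have hab : a = b := by
            have hp : a <+: a ++ L₁.flatten := ⟨_, rfl⟩
            have hp2 : b <+: a ++ L₁.flatten := ⟨L₂.flatten, hf.symm⟩
            rcases Nat.le_total a.length b.length with h | h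
            · exact hS a ha b hb (List.prefix_of_prefix_length_le hp hp2 h)
            · exact (hS b hb a ha (List.prefix_of_prefix_length_le hp2 hp h)).symm
          subst hab
          rw [ih L₂ (fun w hw => h1 w (by simp [hw])) (fun w hw => h2 w (by simp [hw]))
            (List.append_cancel_left hf)]
    have := InformationTheory.kraft_mcmillan_inequality hud
    simpa using this

/-- Weight of a program. -/
noncomputable def wd (U : UniversalPrefixDecompressor) (z p : BStr) : ℝ≥0∞ :=
  if (U.D p z).Dom then 2⁻¹ ^ p.length else 0

theorem kraft (U : UniversalPrefixDecompressor) (z : BStr) : ∑' p, wd U z p ≤ 1 := by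
  rw [ENNReal.tsum_eq_iSup_sum]
  refine iSup_le (fun S => ?_)
  have h1 : ∑ p ∈ S, wd U z p = ∑ p ∈ S.filter (fun p => (U.D p z).Dom), (2⁻¹ : ℝ≥0∞) ^ p.length := by
    rw [Finset.sum_filter]; rfl
  rw [h1]
  have h2 := kraft_finset (S.filter (fun p => (U.D p z).Dom)) (by
    intro p hp q hq hpq
    exact U.prefixFree z p q (Finset.mem_filter.1 hp).2 (Finset.mem_filter.1 hq).2 hpq)
  have h3 := ENNReal.ofReal_le_ofReal h2
  rw [ENNReal.ofReal_sum_of_nonneg (fun _ _ => by positivity), ENNReal.ofReal_one] at h3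
  refine le_trans (le_of_eq (Finset.sum_congr rfl fun p _ => ?_)) h3
  rw [← ofReal_inv_pow]
  congr 1
  rw [one_div_pow]

theorem geo (m : ℝ≥0∞) : ∑' j : ℕ, (if (2⁻¹ : ℝ≥0∞) ^ j ≤ m then (2⁻¹ : ℝ≥0∞) ^ (j + 1) else 0) ≤ m := by
  by_cases h : ∃ j : ℕ, (2⁻¹ : ℝ≥0∞) ^ j ≤ m
  · set j0 := Nat.find h with hj
    have h0 : (2⁻¹ : ℝ≥0∞) ^ j0 ≤ m := Nat.find_spec h
    rw [← Summable.sum_add_tsum_nat_add' (k := j0) ENNReal.summable]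
    rw [Finset.sum_eq_zero, zero_add]
    · calc _ ≤ ∑' i : ℕ, (2⁻¹ : ℝ≥0∞) ^ j0 * (2⁻¹ : ℝ≥0∞) ^ (i + 1) := by
            refine ENNReal.tsum_le_tsum (fun i => ?_)
            split_ifs
            · rw [← pow_add]; apply le_of_eq; congr 1; ring
            · exact zero_le
        _ = (2⁻¹ : ℝ≥0∞) ^ j0 := by
            rw [ENNReal.tsum_mul_left, ENNReal.tsum_geometric_add_one, ENNReal.one_sub_inv_two,
              inv_inv, ENNReal.inv_mul_cancel (by norm_num) (by norm_num), mul_one]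
        _ ≤ m := h0
    · intro j hj'
      rw [if_neg (Nat.find_min h (Finset.mem_range.1 hj'))]
  · push Not at h
    have : ∀ j : ℕ, (if (2⁻¹ : ℝ≥0∞) ^ j ≤ m then (2⁻¹ : ℝ≥0∞) ^ (j + 1) else 0) = 0 :=
      fun j => if_neg (not_le.2 (h j))
    simp [this]

/-- Keep only requests for `x`. -/
def fl (x : BStr) (o : Option (BStr × ℕ)) : Option (BStr × ℕ) :=
  o.bind (fun v => if v.1 = x then some v else none)

theorem fl_primrec : Primrec₂ fl := by
  refine Primrec.option_bind Primrec.snd ?_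
  exact Primrec.ite (Primrec.eq.comp (Primrec.fst.comp Primrec.snd) (Primrec.fst.comp Primrec.fst))
    (Primrec.option_some.comp Primrec.snd) (Primrec.const _)

theorem tsum_fl (o : Option (BStr × ℕ)) : ∑' x, wo (fl x o) = wo o := by
  cases o with
  | none => simp [fl]
  | some v =>
    rw [tsum_eq_single v.1]
    · simp [fl]
    · intro x hx
      simp [fl, hx.symm]

theorem thr_partrec {s : BStr → BStr → ℕ → ℕ × ℕ}
    (hst : Computable₂ (fun (q : BStr × BStr) T => s q.1 q.2 T)) :
    Partrec₂ (fun (z : BStr) (w : BStr × ℕ) => Nat.rfindOpt (fun T =>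
      if 2 ^ (s z w.1 T).2 ≤ (s z w.1 T).1 * 2 ^ w.2 then some (w.1, w.2 + 1) else none)) := by
  have hs : Computable (fun q : (BStr × BStr × ℕ) × ℕ => s q.1.1 q.1.2.1 q.2) :=
    Computable₂.comp hst (g := fun q : (BStr × BStr × ℕ) × ℕ => (q.1.1, q.1.2.1))
      (Computable.pair (Computable.fst.comp Computable.fst)
        (Computable.fst.comp (Computable.snd.comp Computable.fst))) Computable.snd
  have hp : Primrec (fun r : (ℕ × ℕ) × (BStr × ℕ) =>
      if 2 ^ r.1.2 ≤ r.1.1 * 2 ^ r.2.2 then some (r.2.1, r.2.2 + 1) else none) := by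
    have hj : Primrec (fun r : (ℕ × ℕ) × (BStr × ℕ) => r.2.2) := Primrec.snd.comp Primrec.snd
    refine Primrec.ite (Primrec.nat_le.comp (pow2_primrec.comp (Primrec.snd.comp Primrec.fst))
      (Primrec.nat_mul.comp (Primrec.fst.comp Primrec.fst) (pow2_primrec.comp hj))) ?_
      (Primrec.const _)
    exact Primrec.option_some.comp (Primrec.pair (Primrec.fst.comp Primrec.snd)
      (Primrec.succ.comp hj))
  have h2 : Computable₂ (fun (q : BStr × BStr × ℕ) (T : ℕ) =>
      if 2 ^ (s q.1 q.2.1 T).2 ≤ (s q.1 q.2.1 T).1 * 2 ^ q.2.2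
        then some (q.2.1, q.2.2 + 1) else none) :=
    hp.to_comp.comp (Computable.pair hs (Computable.snd.comp Computable.fst))
  exact Partrec.rfindOpt h2

/-- Coding theorem. -/
theorem coding (U : UniversalPrefixDecompressor) (e : BStr → ℕ → Option (BStr × ℕ))
    (he : Computable₂ e) : ∃ c : ℕ, ∀ z, ∑' t, wo (e z t) ≤ 1 →
      ∀ x, ∑' t, wo (fl x (e z t)) ≤ 2 ^ c * 2⁻¹ ^ K U x z := by
  let f : BStr → BStr → ℕ → Option (BStr × ℕ) := fun z x t => fl x (e z t)
  have hf : Computable₂ (fun (q : BStr × BStr) t => f q.1 q.2 t) :=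
    fl_primrec.to_comp.comp (Computable.snd.comp Computable.fst)
      (he.comp (Computable.fst.comp Computable.fst) Computable.snd)
  let F : BStr → BStr × ℕ →. BStr × ℕ := fun z w =>
    Nat.rfindOpt (fun T => if 2 ^ (st (f z w.1) T).2 ≤ (st (f z w.1) T).1 * 2 ^ w.2
      then some (w.1, w.2 + 1) else none)
  have hF : Partrec₂ F := by
    have hst := st_computable hf
    exact thr_partrec (s := fun z x T => st (f z x) T) hst
  have hiff : ∀ z x (j T : ℕ), 2 ^ (st (f z x) T).2 ≤ (st (f z x) T).1 * 2 ^ j ↔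
      1 / 2 ^ j ≤ pos (f z x) T := by
    intro z x j T
    unfold pos
    rw [div_le_div_iff₀ (by positivity) (by positivity), one_mul]
    exact_mod_cast Iff.rfl
  obtain ⟨c, hc⟩ := KC_part U hF
  refine ⟨c + 2, fun z hz x => ?_⟩
  have hmem : ∀ x j v, v ∈ F z (x, j) → v = (x, j + 1) ∧
      (2⁻¹ : ℝ≥0∞) ^ j ≤ ∑' t, wo (f z x t) := by
    intro x j v hv
    obtain ⟨T, hT⟩ := Nat.rfindOpt_spec hv
    simp only [Option.mem_def] at hT
    split_ifs at hT with hcond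
    refine ⟨(Option.some.inj hT).symm, ?_⟩
    rw [← ofReal_inv_pow]
    exact (ENNReal.ofReal_le_ofReal ((hiff _ _ _ _).1 hcond)).trans (ofReal_pos_le _ _)
  have htot : ∑' x, ∑' t, wo (f z x t) ≤ 1 := by
    rw [ENNReal.tsum_comm]
    refine le_trans (le_of_eq (tsum_congr fun t => ?_)) hz
    exact tsum_fl _
  have hsum : ∑' w, wp (F z w) ≤ 1 := by
    rw [ENNReal.tsum_prod']
    refine le_trans (ENNReal.tsum_le_tsum fun x => ?_) htot
    refine le_trans (ENNReal.tsum_le_tsum fun j => ?_) (geo (∑' t, wo (f z x t)))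
    apply wp_le
    intro v hv
    obtain ⟨rfl, h2⟩ := hmem x j v hv
    rw [if_pos h2]
  have hK := hc z hsum
  by_contra hcon
  push Not at hcon
  have hm1 : ∑' t, wo (f z x t) ≤ 1 := (ENNReal.le_tsum x).trans htot
  have hpow : ∀ n : ℕ, (2 : ℝ≥0∞) ^ n * 2⁻¹ ^ n = 1 := by
    intro n
    rw [← mul_pow, ENNReal.mul_inv_cancel (by norm_num) (by norm_num), one_pow]
  rcases le_or_gt (c + 2) (K U x z) with hle | hgt
  · obtain ⟨j, hj⟩ := Nat.exists_eq_add_of_le hle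
    rw [hj, pow_add (2⁻¹ : ℝ≥0∞), ← mul_assoc, hpow, one_mul] at hcon
    rw [ENNReal.tsum_eq_iSup_nat] at hcon
    obtain ⟨T, hT⟩ := lt_iSup_iff.1 hcon
    have hT' : 1 / 2 ^ j ≤ pos (f z x) T := by
      rw [← ofReal_pos (f z x) T, ← ofReal_inv_pow] at hT
      exact ((ENNReal.ofReal_lt_ofReal_iff_of_nonneg (by positivity)).1 hT).le
    have hdom : (F z (x, j)).Dom := by
      refine Nat.rfindOpt_dom.2 ⟨T, (x, j + 1), ?_⟩
      simp only [Option.mem_def]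
      rw [if_pos ((hiff _ _ _ _).2 hT')]
    have hv := Part.get_mem hdom
    rw [(hmem x j _ hv).1] at hv
    have := hK _ _ _ hv
    omega
  · obtain ⟨j, hj⟩ := Nat.exists_eq_add_of_le hgt.le
    rw [hj, pow_add, mul_assoc, mul_comm, mul_assoc, mul_comm (2⁻¹ ^ _), hpow, mul_one] at hcon
    have h1 : (1 : ℝ≥0∞) ≤ 2 ^ j := one_le_pow₀ (by norm_num)
    exact absurd (hcon.trans_le hm1) (not_lt.2 h1)

/-! ### Chain rules -/

theorem transform (U : UniversalPrefixDecompressor) {g h : BStr →. BStr} (hg : Partrec g)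
    (hh : Partrec h) : ∃ c : ℕ, ∀ x x' y y', y' ∈ g y → x ∈ h x' → K U x y ≤ K U x' y' + c := by
  let D : BStr → BStr →. BStr := fun p y => (g y).bind (fun y' => (U.D p y').bind h)
  have hD : Partrec₂ D := by
    refine Partrec.bind (hg.comp Computable.snd) ?_
    refine Partrec.bind (U.partrec.comp (Computable.fst.comp Computable.fst) Computable.snd) ?_
    exact hh.comp Computable.snd
  have hpf : PrefixFreeDom D := by
    intro y p q hp hq hpq
    obtain ⟨a, ha⟩ := Part.dom_iff_mem.1 hp
    obtain ⟨b, hb⟩ := Part.dom_iff_mem.1 hq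
    obtain ⟨y1, hy1, ha⟩ := Part.mem_bind_iff.1 ha
    obtain ⟨y2, hy2, hb⟩ := Part.mem_bind_iff.1 hb
    obtain rfl := Part.mem_unique hy1 hy2
    obtain ⟨s1, hs1, _⟩ := Part.mem_bind_iff.1 ha
    obtain ⟨s2, hs2, _⟩ := Part.mem_bind_iff.1 hb
    exact U.prefixFree y1 p q (Part.dom_iff_mem.2 ⟨_, hs1⟩) (Part.dom_iff_mem.2 ⟨_, hs2⟩) hpq
  obtain ⟨c, hc⟩ := U.universal D hD hpf
  refine ⟨c, fun x x' y y' hy hx => ?_⟩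
  obtain ⟨p, hp, hpx⟩ := K_spec U x' y'
  have hmem : x ∈ D p y := Part.mem_bind_iff.2 ⟨y', hy, Part.mem_bind_iff.2 ⟨x', hpx, hx⟩⟩
  have h1 := hc x y ⟨p, hmem⟩
  have h2 := condC_le D hmem
  unfold K at *
  omega

theorem chain_easy (U : UniversalPrefixDecompressor) : ∃ c : ℕ, ∀ x y z,
    K U (pairStr x y) z ≤ K U x z + K U y (tripStr x (natStr (K U x z)) z) + c := by
  let F : BStr → BStr × BStr →. BStr × ℕ := fun z w =>
    (U.D w.1 z).bind (fun s => (U.D w.2 (tripStr s (natStr w.1.length) z)).map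
      (fun s' => (pairStr s s', w.1.length + w.2.length)))
  have hF : Partrec₂ F := by
    have hp1 : Computable (fun q : BStr × BStr × BStr => q.2.1) :=
      Computable.fst.comp Computable.snd
    have hp2 : Computable (fun q : BStr × BStr × BStr => q.2.2) :=
      Computable.snd.comp Computable.snd
    refine Partrec.bind (U.partrec.comp hp1 Computable.fst) ?_
    refine Partrec.map (U.partrec.comp (hp2.comp Computable.fst)
      (trip_comp Computable.snd
        (natStr_primrec.to_comp.comp (Computable.list_length.comp (hp1.comp Computable.fst)))
        (Computable.fst.comp Computable.fst))) ?_
    refine Computable.pair (pair_comp (Computable.snd.comp Computable.fst) Computable.snd) ?_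
    exact Primrec.nat_add.to_comp.comp
      (Computable.list_length.comp (hp1.comp (Computable.fst.comp Computable.fst)))
      (Computable.list_length.comp (hp2.comp (Computable.fst.comp Computable.fst)))
  obtain ⟨c, hc⟩ := KC_part U hF
  refine ⟨c, fun x y z => ?_⟩
  have hsum : ∑' w, wp (F z w) ≤ 1 := by
    rw [ENNReal.tsum_prod']
    refine le_trans (ENNReal.tsum_le_tsum fun p => ?_) (kraft U z)
    by_cases hd : (U.D p z).Dom
    · obtain ⟨s, hs⟩ := Part.dom_iff_mem.1 hd
      calc ∑' r, wp (F z (p, r))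
          ≤ ∑' r, 2⁻¹ ^ p.length * wd U (tripStr s (natStr p.length) z) r := by
            refine ENNReal.tsum_le_tsum fun r => wp_le fun v hv => ?_
            obtain ⟨s1, hs1, hv⟩ := Part.mem_bind_iff.1 hv
            obtain rfl := Part.mem_unique hs hs1
            obtain ⟨s2, hs2, rfl⟩ := (Part.mem_map_iff _).1 hv
            have : (U.D r (tripStr s (natStr p.length) z)).Dom := Part.dom_iff_mem.2 ⟨_, hs2⟩
            rw [wd, if_pos this, ← pow_add]
        _ ≤ 2⁻¹ ^ p.length * 1 := by
            rw [ENNReal.tsum_mul_left]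
            exact mul_le_mul_right (kraft U _) _
        _ = wd U z p := by rw [mul_one, wd, if_pos hd]
    · refine le_trans (le_of_eq ?_) zero_le
      rw [ENNReal.tsum_eq_zero]
      intro r
      refine le_antisymm (wp_le fun v hv => ?_) zero_le
      obtain ⟨s1, hs1, _⟩ := Part.mem_bind_iff.1 hv
      exact absurd (Part.dom_iff_mem.2 ⟨_, hs1⟩) hd
  obtain ⟨p, hp, hpx⟩ := K_spec U x z
  obtain ⟨r, hr, hry⟩ := K_spec U y (tripStr x (natStr (K U x z)) z)
  have hmem : (pairStr x y, p.length + r.length) ∈ F z (p, r) := by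
    refine Part.mem_bind_iff.2 ⟨x, hpx, (Part.mem_map_iff _).2 ⟨y, ?_, rfl⟩⟩
    simp only [hp]
    exact hry
  have := hc z hsum _ _ _ hmem
  omega

theorem pow_sub_le (a k : ℕ) : (2⁻¹ : ℝ≥0∞) ^ (a - k) ≤ 2 ^ k * 2⁻¹ ^ a := by
  have hpow : ∀ n : ℕ, (2 : ℝ≥0∞) ^ n * 2⁻¹ ^ n = 1 := by
    intro n
    rw [← mul_pow, ENNReal.mul_inv_cancel (by norm_num) (by norm_num), one_pow]
  rcases le_total k a with h | h
  · obtain ⟨d, rfl⟩ := Nat.exists_eq_add_of_le h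
    rw [pow_add, ← mul_assoc, hpow, one_mul]; simp
  · obtain ⟨d, rfl⟩ := Nat.exists_eq_add_of_le h
    rw [pow_add, mul_right_comm, hpow, one_mul, Nat.sub_eq_zero_of_le h, pow_zero]
    exact one_le_pow₀ (by norm_num)

theorem K_fst_le (U : UniversalPrefixDecompressor) : ∃ c : ℕ, ∀ x y z,
    K U x z ≤ K U (pairStr x y) z + c := by
  obtain ⟨c, hc⟩ := transform U (g := fun y => Part.some y) (h := fun s => Part.some (unP s).1)
    Partrec.some (Computable.fst.comp unP_primrec.to_comp)
  exact ⟨c, fun x y z => hc _ _ _ _ (Part.mem_some _) (by simp)⟩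

/-- Requests for the second component. -/
def selReq (c : ℕ) (q : BStr × BStr × BStr) (o : Option (BStr × ℕ)) : Option (BStr × ℕ) :=
  o.bind (fun v => if (unP v.1).1 = q.1 then some ((unP v.1).2, v.2 + c - ofB q.2.1) else none)

theorem selReq_primrec (c : ℕ) : Primrec₂ (selReq c) := by
  let Q := ((BStr × BStr × BStr) × Option (BStr × ℕ)) × (BStr × ℕ)
  have hv : Primrec (fun r : Q => unP r.2.1) := unP_primrec.comp (Primrec.fst.comp Primrec.snd)
  refine Primrec.option_bind Primrec.snd ?_
  refine Primrec.ite (Primrec.eq.comp (Primrec.fst.comp hv)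
    (Primrec.fst.comp (Primrec.fst.comp Primrec.fst))) ?_ (Primrec.const _)
  refine Primrec.option_some.comp (Primrec.pair (Primrec.snd.comp hv) ?_)
  refine Primrec.nat_sub.comp (Primrec.nat_add.comp (Primrec.snd.comp Primrec.snd)
    (Primrec.const c)) ?_
  exact ofB_primrec.comp (Primrec.fst.comp (Primrec.snd.comp (Primrec.fst.comp Primrec.fst)))

theorem chain_hard (U : UniversalPrefixDecompressor) : ∃ c : ℕ, ∀ x y z,
    K U y (tripStr x (natStr (K U x z)) z) + K U x z ≤ K U (pairStr x y) z + c := by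
  let F : BStr → BStr →. BStr × ℕ := fun z p => (U.D p z).map (fun s => (s, p.length))
  have hF : Partrec₂ F := by
    refine Partrec.map (U.partrec.comp Computable.snd Computable.fst) ?_
    exact Computable.pair Computable.snd
      (Computable.list_length.comp (Computable.snd.comp Computable.fst))
  obtain ⟨e, he, hes, hem⟩ := enum_exists hF
  have hFsum : ∀ z, ∑' p, wp (F z p) ≤ 1 := by
    intro z
    refine le_trans (ENNReal.tsum_le_tsum fun p => wp_le fun v hv => ?_) (kraft U z)
    obtain ⟨s, hs, rfl⟩ := (Part.mem_map_iff _).1 hv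
    rw [wd, if_pos (Part.dom_iff_mem.2 ⟨_, hs⟩)]
  have hesum : ∀ z, ∑' t, wo (e z t) ≤ 1 := fun z => (hes z).trans (hFsum z)
  let e1 : BStr → ℕ → Option (BStr × ℕ) := fun z t =>
    (e z t).map (fun v => ((unP v.1).1, v.2))
  have he1 : Computable₂ e1 := by
    refine Computable.option_map he ?_
    exact Computable.pair (Computable.fst.comp (unP_primrec.to_comp.comp
      (Computable.fst.comp Computable.snd))) (Computable.snd.comp Computable.snd)
  have he1sum : ∀ z, ∑' t, wo (e1 z t) ≤ 1 := by
    intro z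
    refine le_trans (le_of_eq (tsum_congr fun t => ?_)) (hesum z)
    simp only [e1]
    cases e z t <;> simp
  obtain ⟨c1, hc1⟩ := coding U e1 he1
  let e3 : BStr → ℕ → Option (BStr × ℕ) := fun s t => selReq c1 (unT s) (e (unT s).2.2 t)
  have he3 : Computable₂ e3 := by
    have hu : Computable (fun r : BStr × ℕ => unT r.1) := unT_primrec.to_comp.comp Computable.fst
    exact (selReq_primrec c1).to_comp.comp hu
      (he.comp (Computable.snd.comp (Computable.snd.comp hu)) Computable.snd)
  obtain ⟨c2, hc2⟩ := KC_enum U e3 he3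
  obtain ⟨c3, hc3⟩ := K_fst_le U
  refine ⟨c1 + c2 + c3, fun x y z => ?_⟩
  set k := K U x z with hk
  have hsum : ∑' t, wo (e3 (tripStr x (natStr k) z) t) ≤ 1 := by
    calc ∑' t, wo (e3 (tripStr x (natStr k) z) t)
        ≤ ∑' t, (2 ^ k * 2⁻¹ ^ c1) * wo (fl x (e1 z t)) := by
          refine ENNReal.tsum_le_tsum fun t => ?_
          simp only [e3, e1, unT_tripStr, selReq, ofB_natStr]
          cases e z t with
          | none => simp
          | some v =>
            simp only [Option.bind_some, Option.map_some, fl]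
            split_ifs with hx
            · simp only [wo_some]
              refine (pow_sub_le _ _).trans (le_of_eq ?_)
              rw [pow_add]; ring
            · simp
      _ ≤ (2 ^ k * 2⁻¹ ^ c1) * (2 ^ c1 * 2⁻¹ ^ k) := by
          rw [ENNReal.tsum_mul_left]
          exact mul_le_mul_right (hc1 z (he1sum z) x) _
      _ = (2 * 2⁻¹) ^ k * (2 * 2⁻¹) ^ c1 := by rw [mul_pow, mul_pow]; ring
      _ = 1 := by rw [ENNReal.mul_inv_cancel (by norm_num) (by norm_num)]; simp
  obtain ⟨p, hp, hpx⟩ := K_spec U (pairStr x y) z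
  obtain ⟨t, ht⟩ := hem z p _ ((Part.mem_map_iff _).2 ⟨_, hpx, rfl⟩)
  have h3 : e3 (tripStr x (natStr k) z) t = some (y, p.length + c1 - k) := by
    simp [e3, selReq, ofB_natStr, ht]
  have h4 := hc2 _ hsum _ _ _ h3
  have h5 := hc3 x y z
  omega

theorem exists_bound (N : ℕ) (c : BStr → ℕ) : ∃ C, ∀ p : BStr, p.length ≤ N → c p ≤ C := by
  have hfin : {p : BStr | p.length ≤ N}.Finite := List.finite_length_le Bool N
  obtain ⟨C, hC⟩ := (hfin.image c).bddAbove
  exact ⟨C, fun p hp => hC ⟨p, hp, rfl⟩⟩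

theorem condC_spec (Oc : CondOptimalDecompressor) (x y : BStr) :
    ∃ p : BStr, p.length = condC Oc.Vc x y ∧ x ∈ Oc.Vc p y := by
  have : (condC Oc.Vc x y) ∈ {n | ∃ p : BStr, p.length = n ∧ x ∈ Oc.Vc p y} := by
    apply Nat.sInf_mem
    obtain ⟨p, hp⟩ := Oc.onto x y
    exact ⟨p.length, p, rfl, hp⟩
  exact this

/-- Change of condition, first direction. -/
theorem shift_down (U : UniversalPrefixDecompressor) (c₀ : ℕ) : ∃ c : ℕ, ∀ x s A B N Q,
    K U N Q ≤ c₀ → K U x (tripStr (pairStr s A) B Q) ≤ K U x (tripStr s A N) + c := by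
  have h : ∀ r : BStr, ∃ c : ℕ, ∀ x s A B N Q, N ∈ U.D r Q →
      K U x (tripStr (pairStr s A) B Q) ≤ K U x (tripStr s A N) + c := by
    intro r
    have hg : Partrec (fun w : BStr => (U.D r (unT w).2.2).map
        (fun n => tripStr (unP (unT w).1).1 (unP (unT w).1).2 n)) := by
      have hu := unT_primrec.to_comp
      refine Partrec.map (U.partrec.comp (Computable.const r)
        (Computable.snd.comp (Computable.snd.comp hu))) ?_
      have hp : Computable (fun q : BStr × BStr => unP (unT q.1).1) :=
        unP_primrec.to_comp.comp (Computable.fst.comp (hu.comp Computable.fst))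
      exact trip_comp (Computable.fst.comp hp) (Computable.snd.comp hp) Computable.snd
    obtain ⟨c, hc⟩ := transform U hg Partrec.some
    refine ⟨c, fun x s A B N Q hN => hc _ _ _ _ ?_ (Part.mem_some _)⟩
    refine (Part.mem_map_iff _).2 ⟨N, ?_, ?_⟩ <;> simp [hN]
  choose cf hcf using h
  obtain ⟨C, hC⟩ := exists_bound c₀ cf
  refine ⟨C, fun x s A B N Q hN => ?_⟩
  obtain ⟨r, hr, hrN⟩ := K_spec U N Q
  have h1 := hcf r x s A B N Q hrN
  have h2 := hC r (hr.trans_le hN)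
  omega

/-- Change of condition, second direction. -/
theorem shift_up (Oc : CondOptimalDecompressor) (U : UniversalPrefixDecompressor) (c₀ c₁ : ℕ) :
    ∃ c : ℕ, ∀ x s A B N Q, condC Oc.Vc Q s ≤ c₀ → K U B (tripStr s A N) ≤ c₁ →
      K U x (tripStr s A N) ≤ K U x (tripStr (pairStr s A) B Q) + c := by
  have h : ∀ r r' : BStr, ∃ c : ℕ, ∀ x s A B N Q, Q ∈ Oc.Vc r s → B ∈ U.D r' (tripStr s A N) →
      K U x (tripStr s A N) ≤ K U x (tripStr (pairStr s A) B Q) + c := by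
    intro r r'
    have hg : Partrec (fun w : BStr => (Oc.Vc r (unT w).1).bind (fun q => (U.D r' w).map
        (fun b => tripStr (pairStr (unT w).1 (unT w).2.1) b q))) := by
      have hu := unT_primrec.to_comp
      refine Partrec.bind (Oc.partrec.comp (Computable.const r) (Computable.fst.comp hu)) ?_
      refine Partrec.map (U.partrec.comp (Computable.const r') Computable.fst) ?_
      have hw : Computable (fun v : (BStr × BStr) × BStr => unT v.1.1) :=
        hu.comp (Computable.fst.comp Computable.fst)
      exact trip_comp
        (pair_comp (Computable.fst.comp hw) (Computable.fst.comp (Computable.snd.comp hw)))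
        Computable.snd (Computable.snd.comp Computable.fst)
    obtain ⟨c, hc⟩ := transform U hg Partrec.some
    refine ⟨c, fun x s A B N Q hQ hB => hc _ _ _ _ ?_ (Part.mem_some _)⟩
    refine Part.mem_bind_iff.2 ⟨Q, by simpa using hQ, (Part.mem_map_iff _).2 ⟨B, hB, by simp⟩⟩
  choose cf hcf using h
  have h' : ∀ r, ∃ C, ∀ r' : BStr, r'.length ≤ c₁ → cf r r' ≤ C := fun r => exists_bound c₁ (cf r)
  choose cg hcg using h'
  obtain ⟨C, hC⟩ := exists_bound c₀ cg
  refine ⟨C, fun x s A B N Q hQ hB => ?_⟩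
  obtain ⟨r, hr, hrQ⟩ := condC_spec Oc Q s
  obtain ⟨r', hr', hrB⟩ := K_spec U B (tripStr s A N)
  have h1 := hcf r r' x s A B N Q hrQ hrB
  have h2 := hcg r r' (hr'.trans_le hB)
  have h3 := hC r (hr.trans_le hQ)
  omega

theorem K_map (U : UniversalPrefixDecompressor) {h : BStr → BStr} (hh : Computable h) :
    ∃ c : ℕ, ∀ x y, K U (h x) y ≤ K U x y + c := by
  obtain ⟨c, hc⟩ := transform U (g := fun y => Part.some y) (h := fun s => Part.some (h s))
    Partrec.some hh
  exact ⟨c, fun x y => hc _ _ _ _ (Part.mem_some _) (Part.mem_some _)⟩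

theorem main (Oc : CondOptimalDecompressor) (U : UniversalPrefixDecompressor) (c₀ : ℕ) :
    ∃ c : ℕ, ∀ N Q s x : BStr, ∀ A B : BStr,
      A = natStr (K U s N) → B = natStr (K U (pairStr s A) Q) →
      K U N Q ≤ c₀ → condC Oc.Vc Q s ≤ c₀ →
      K U (tripStr s A B) N ≤ K U s N + c₀ →
      (K U (tripStr x s A) Q + K U s N ≤ K U (pairStr s A) Q + K U (pairStr s x) N + c ∧
       K U (pairStr s A) Q + K U (pairStr s x) N ≤ K U (tripStr x s A) Q + K U s N + c) := by
  have hu := unT_primrec.to_comp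
  have hup := unP_primrec.to_comp
  -- `(s, A, B) ↦ (s, B)`
  obtain ⟨d1, hd1⟩ := K_map U (h := fun w => pairStr (unT w).1 (unT w).2.2)
    (pair_comp (Computable.fst.comp hu)
      (Computable.snd.comp (Computable.snd.comp hu)))
  -- `((s, A), x) ↦ (x, s, A)`
  obtain ⟨d2, hd2⟩ := K_map U
    (h := fun w => tripStr (unP w).2 (unP (unP w).1).1 (unP (unP w).1).2)
    (trip_comp (Computable.snd.comp hup)
      (Computable.fst.comp (hup.comp (Computable.fst.comp hup)))
      (Computable.snd.comp (hup.comp (Computable.fst.comp hup))))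
  -- `(x, s, A) ↦ ((s, A), x)`
  obtain ⟨d3, hd3⟩ := K_map U
    (h := fun w => pairStr (pairStr (unT w).2.1 (unT w).2.2) (unT w).1)
    (pair_comp (pair_comp
      (Computable.fst.comp (Computable.snd.comp hu)) (Computable.snd.comp (Computable.snd.comp hu)))
      (Computable.fst.comp hu))
  obtain ⟨e1, he1⟩ := chain_easy U
  obtain ⟨e2, he2⟩ := chain_hard U
  obtain ⟨e3, he3⟩ := shift_down U c₀
  obtain ⟨e4, he4⟩ := shift_up Oc U c₀ (c₀ + d1 + e2)
  refine ⟨d1 + d2 + d3 + 2 * e1 + 2 * e2 + e3 + e4, ?_⟩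
  intro N Q s x A B hA hB hNQ hQs hdec
  have a1 := hd1 (tripStr s A B) N
  have a2 := hd2 (pairStr (pairStr s A) x) Q
  have a3 := hd3 (tripStr x s A) Q
  simp only [unT_tripStr, unP_pairStr] at a1 a2 a3
  have b1 := he1 s x N
  have b2 := he1 (pairStr s A) x Q
  have b3 := he2 s B N
  have b4 := he2 s x N
  have b5 := he2 (pairStr s A) x Q
  rw [← hA] at b1 b3 b4
  rw [← hB] at b2 b5
  have c1 := he3 x s A B N Q hNQ
  have c2 := he4 x s A B N Q hQs (by omega)
  constructor <;> omega

end KShift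

/-- The complexity symmetry shift. For every constant `c₀` there
is a constant `c` such that for all integers `n, q`, strings `q̃, x`: if
`K(n | q) ≤ c₀`, `C_V(q | q̃) ≤ c₀`, and (with `α = K(q̃ | n)`)
`|K(q̃ | n) − K(q̃, α, K(q̃, α | q) | n)| ≤ c₀`, then
`|(K(x, q̃, α | q) − K(q̃, α | q)) − (K(q̃, x | n) − K(q̃ | n))| ≤ c`. -/
theorem complexity_symmetry_shift
    (Oc : CondOptimalDecompressor) (U : UniversalPrefixDecompressor) :
    ∀ c₀ : ℕ, ∃ c : ℕ, ∀ n q : ℕ, ∀ qt x : BStr,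
      K U (natStr n) (natStr q) ≤ c₀ →
      condC Oc.Vc (natStr q) qt ≤ c₀ →
      K U qt (natStr n) ≤
          K U (tripStr qt (natStr (K U qt (natStr n)))
            (natStr (K U (pairStr qt (natStr (K U qt (natStr n)))) (natStr q))))
            (natStr n) + c₀ →
      K U (tripStr qt (natStr (K U qt (natStr n)))
            (natStr (K U (pairStr qt (natStr (K U qt (natStr n)))) (natStr q))))
            (natStr n) ≤ K U qt (natStr n) + c₀ →
      (K U (tripStr x qt (natStr (K U qt (natStr n)))) (natStr q) + K U qt (natStr n) ≤
          K U (pairStr qt (natStr (K U qt (natStr n)))) (natStr q) +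
            K U (pairStr qt x) (natStr n) + c ∧
       K U (pairStr qt (natStr (K U qt (natStr n)))) (natStr q) +
            K U (pairStr qt x) (natStr n) ≤
          K U (tripStr x qt (natStr (K U qt (natStr n)))) (natStr q) +
            K U qt (natStr n) + c) := by
  intro c₀
  obtain ⟨c, hc⟩ := KShift.main Oc U c₀
  refine ⟨c, fun n q qt x h1 h2 _ h4 => ?_⟩
  exact hc (natStr n) (natStr q) qt x _ _ rfl rfl h1 h2 h4
end

section
/- There exists a partial computable function g such that for every integer n and all strings a, b with |a| + |b| < n/2, the computation g(n, a, b, w_n) halts and outputs the exact value K(a | b). -/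
open scoped Classical ENNReal

/-- Stage approximation to `U.D`. -/
theorem exists_stage (D : BStr → BStr →. BStr) (hD : Partrec₂ D) :
    ∃ S : ℕ → ℕ × BStr × BStr → Bool, Computable₂ S ∧
      (∀ t t' q, t ≤ t' → S t q = true → S t' q = true) ∧
      (∀ k a b, (∃ t, S t (k, a, b) = true) ↔ ∃ p : BStr, p.length = k ∧ a ∈ D p b) := by
  obtain ⟨c, hc⟩ := Nat.Partrec.Code.exists_code.1 hD
  have hev : ∀ p b a : BStr, Encodable.encode a ∈ c.eval (Encodable.encode (p, b)) ↔
      a ∈ D p b := by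
    intro p b a
    rw [hc]
    simp
  let P : ℕ → BStr := fun x => (Encodable.decode (α := BStr) x).getD []
  have hP : Primrec P := Primrec.option_getD.comp Primrec.decode (Primrec.const [])
  let R : ℕ → ℕ × ℕ × BStr × BStr → Prop := fun x q =>
    (P x).length = q.2.1 ∧
      c.evaln q.1 (Encodable.encode (P x, q.2.2.2)) = some (Encodable.encode q.2.2.1)
  have hR : PrimrecRel R := by
    refine PrimrecPred.and ?_ ?_
    · exact Primrec.eq.comp (Primrec.list_length.comp (hP.comp Primrec.fst))
        (Primrec.fst.comp (Primrec.snd.comp Primrec.snd))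
    · refine Primrec.eq.comp (Nat.Partrec.Code.primrec_evaln.comp
        (Primrec.pair (Primrec.pair (Primrec.fst.comp Primrec.snd) (Primrec.const c))
          (Primrec.encode.comp (Primrec.pair (hP.comp Primrec.fst)
            (Primrec.snd.comp (Primrec.snd.comp (Primrec.snd.comp Primrec.snd))))))) ?_
      exact Primrec.option_some.comp (Primrec.encode.comp
        (Primrec.fst.comp (Primrec.snd.comp (Primrec.snd.comp Primrec.snd))))
  have hE := PrimrecRel.exists_mem_list hR
  have hE' : PrimrecPred (fun q : ℕ × ℕ × BStr × BStr => ∃ x < q.1, R x q) :=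
    (hE.comp (Primrec.list_range.comp Primrec.fst) Primrec.id).of_eq (by simp)
  obtain ⟨dec, hdec⟩ := hE'
  refine ⟨fun t q => @decide _ (dec (t, q)), hdec.to_comp, ?_, ?_⟩
  · intro t t' q htt h
    simp only [decide_eq_true_eq] at h ⊢
    obtain ⟨x, hx, h1, h2⟩ := h
    exact ⟨x, lt_of_lt_of_le hx htt, h1, Nat.Partrec.Code.evaln_mono htt h2⟩
  · intro k a b
    simp only [decide_eq_true_eq]
    constructor
    · rintro ⟨t, x, hx, h1, h2⟩
      exact ⟨P x, h1, (hev _ _ _).1 (Nat.Partrec.Code.evaln_sound h2)⟩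
    · rintro ⟨p, h1, h2⟩
      obtain ⟨t, ht⟩ := Nat.Partrec.Code.evaln_complete.1 ((hev _ _ _).2 h2)
      have hPp : P (Encodable.encode p) = p := by simp [P]
      refine ⟨max t (Encodable.encode p + 1), Encodable.encode p, by simp, ?_, ?_⟩
      · rw [hPp]; exact h1
      · rw [hPp]
        exact Nat.Partrec.Code.evaln_mono (le_max_left _ _) ht

/-- A simple upper bound for conditional prefix complexity. -/
theorem K_le_linear (U : UniversalPrefixDecompressor) :
    ∃ c, ∀ a b, K U a b ≤ 2 * a.length + 1 + c := by
  let D' : BStr → BStr →. BStr := fun p _ =>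
    ((if p.length = 2 * p.idxOf false + 1 then some (p.drop (p.idxOf false + 1)) else none :
      Option BStr) : Part BStr)
  have hi : Primrec (fun q : BStr × BStr => q.1.idxOf false) :=
    Primrec.list_idxOf.comp (Primrec.const false) Primrec.fst |>.of_eq (fun _ => rfl)
  have hD' : Partrec₂ D' := by
    refine Computable.ofOption (Primrec.to_comp ?_)
    refine Primrec.ite ?_ ?_ (Primrec.const none)
    · exact Primrec.eq.comp (Primrec.list_length.comp Primrec.fst)
        (Primrec.succ.comp (Primrec.nat_mul.comp (Primrec.const 2) hi))
    · exact Primrec.option_some.comp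
        (Primrec.list_drop.comp (Primrec.succ.comp hi) Primrec.fst)
  have hdom : ∀ p y, (D' p y).Dom → p.length = 2 * p.idxOf false + 1 := by
    intro p y h
    by_contra hne
    simp [D', hne] at h
  have hpf : PrefixFreeDom D' := by
    rintro y p q hp hq ⟨r, rfl⟩
    have h1 := hdom _ y hp
    have h2 := hdom _ y hq
    have hmem : false ∈ p := List.idxOf_lt_length_iff.1 (by omega)
    rw [List.idxOf_append_of_mem hmem, List.length_append] at h2
    have : r.length = 0 := by omega
    simp [List.length_eq_zero_iff.1 this]
  obtain ⟨c, hc⟩ := U.universal D' hD' hpf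
  refine ⟨c, fun a b => ?_⟩
  let p : BStr := List.replicate a.length true ++ false :: a
  have hidx : p.idxOf false = a.length := by
    simp [p, List.idxOf_append, List.mem_replicate]
  have hlen : p.length = 2 * a.length + 1 := by simp [p]; omega
  have hp : a ∈ D' p b := by
    simp only [D', hidx, hlen, if_true]
    simp [p, List.drop_append]
  refine (hc a b ⟨p, hp⟩).trans ?_
  have : condC D' a b ≤ 2 * a.length + 1 := Nat.sInf_le ⟨p, hlen, hp⟩
  omega

/-- Strings longer than anything enumerated before time `t`. -/
def freshStr (e : ℕ → Option (BStr × ℕ)) : ℕ → BStr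
  | 0 => [true]
  | t + 1 => true :: (((e t).map Prod.fst).getD [] ++ freshStr e t)

theorem freshStr_computable (e : ℕ → Option (BStr × ℕ)) (he : Computable e) :
    Computable (freshStr e) := by
  have : Computable (fun t : ℕ => (Nat.rec [true]
      (fun m ih => true :: (((e m).map Prod.fst).getD [] ++ ih)) t : BStr)) := by
    refine Computable.nat_rec (h := fun _ (q : ℕ × BStr) =>
      true :: (((e q.1).map Prod.fst).getD [] ++ q.2)) Computable.id
      (Computable.const [true]) ?_
    have h1 : Computable (fun q : ℕ × ℕ × BStr => (e q.2.1)) :=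
      he.comp (Computable.fst.comp Computable.snd)
    have h2 : Computable (fun q : ℕ × ℕ × BStr => (e q.2.1).map Prod.fst) :=
      Computable.option_map h1 (Computable.fst.comp Computable.snd)
    have h3 : Computable (fun q : ℕ × ℕ × BStr => ((e q.2.1).map Prod.fst).getD []) :=
      Computable.option_getD h2 (Computable.const [])
    exact Computable.list_cons.comp (Computable.const true)
      (Computable.list_append.comp h3 (Computable.snd.comp Computable.snd))
  refine this.of_eq (fun t => ?_)
  induction t with
  | zero => rfl
  | succ t ih => simp only [freshStr]; rw [← ih]

theorem freshStr_length (e : ℕ → Option (BStr × ℕ)) (t s : ℕ) (x : BStr) (k : ℕ)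
    (hs : s < t) (h : e s = some (x, k)) : x.length < (freshStr e t).length := by
  induction t with
  | zero => omega
  | succ t ih =>
    simp only [freshStr, List.length_cons, List.length_append]
    rcases Nat.lt_succ_iff_lt_or_eq.1 hs with h1 | h1
    · have := ih h1; omega
    · subst h1; simp [h]
      try omega

/-- Binary value. -/
def binVal (l : BStr) : ℕ := l.foldr (fun b n => 2 * n + (if b then 1 else 0)) 0

theorem binVal_primrec : Primrec binVal := by
  refine Primrec.list_foldr (h := fun _ (q : Bool × ℕ) => 2 * q.2 + (if q.1 then 1 else 0))
    Primrec.id (Primrec.const 0) ?_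
  refine Primrec.nat_add.comp (Primrec.nat_mul.comp (Primrec.const 2)
    (Primrec.snd.comp Primrec.snd)) ?_
  exact (Primrec.cond (Primrec.fst.comp Primrec.snd) (Primrec.const 1) (Primrec.const 0)).of_eq
    (fun q => by cases q.2.1 <;> rfl)

theorem exists_binVal (s m : ℕ) (h : m < 2 ^ s) : ∃ l : BStr, l.length = s ∧ binVal l = m := by
  induction s generalizing m with
  | zero => exact ⟨[], rfl, by simp at h; simp [binVal, h]⟩
  | succ s ih =>
    obtain ⟨l, hl, hv⟩ := ih (m / 2) (by rw [pow_succ] at h; omega)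
    refine ⟨decide (m % 2 = 1) :: l, by simp [hl], ?_⟩
    simp only [binVal, List.foldr_cons] at hv ⊢
    rw [hv]
    by_cases hm : m % 2 = 1
    · simp [hm]; omega
    · simp [hm]; omega

/-- Decoder of a program into a triple `(k, a, b)`. -/
def decTrip (p : BStr) : ℕ × BStr × BStr :=
  let i := p.idxOf false
  let r := p.drop (i + 1)
  let m := (binVal (r.take i)).unpair
  (m.2, (r.drop i).take m.1, (r.drop i).drop m.1)

theorem decTrip_primrec : Primrec decTrip := by
  have hi : Primrec (fun q : BStr => q.idxOf false) :=
    Primrec.list_idxOf.comp (Primrec.const false) Primrec.id |>.of_eq (fun _ => rfl)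
  have hr : Primrec (fun q : BStr => q.drop (q.idxOf false + 1)) :=
    Primrec.list_drop.comp (Primrec.succ.comp hi) Primrec.id
  have hm : Primrec (fun q : BStr =>
      (binVal ((q.drop (q.idxOf false + 1)).take (q.idxOf false))).unpair) :=
    Primrec.unpair.comp (binVal_primrec.comp (Primrec.list_take.comp hi hr))
  have hb := Primrec.list_drop.comp hi hr
  exact Primrec.pair (Primrec.snd.comp hm)
    (Primrec.pair (Primrec.list_take.comp (Primrec.fst.comp hm) hb)
      (Primrec.list_drop.comp (Primrec.fst.comp hm) hb))

theorem exists_decTrip (s k : ℕ) (a b : BStr) (h : Nat.pair a.length k < 2 ^ s) :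
    ∃ p : BStr, p.length = 2 * s + 1 + (a.length + b.length) ∧ decTrip p = (k, a, b) := by
  obtain ⟨l, hl, hv⟩ := exists_binVal s _ h
  let p : BStr := List.replicate s true ++ false :: (l ++ (a ++ b))
  refine ⟨p, by simp [p, hl]; omega, ?_⟩
  have hidx : p.idxOf false = s := by
    simp [p, List.idxOf_append, List.mem_replicate]
  have hd : p.drop (s + 1) = l ++ (a ++ b) := by
    simp [p, List.drop_append]
  have ht : (l ++ (a ++ b)).take s = l := by
    rw [← hl]; exact List.take_left
  have hd2 : (l ++ (a ++ b)).drop s = a ++ b := by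
    rw [← hl]; exact List.drop_left
  simp only [decTrip, hidx, hd, ht, hd2, hv, Nat.unpair_pair, List.take_left, List.drop_left]

theorem sq_le_two_pow_aux (s : ℕ) : s ^ 2 ≤ 2 ^ s + 1 := by
  by_cases h : s < 4
  · interval_cases s <;> norm_num
  · push Not at h
    induction s, h using Nat.le_induction with
    | base => norm_num
    | succ s hs ih =>
      rw [pow_succ 2 s]
      nlinarith

theorem size_bound (c M : ℕ) : ∃ N, ∀ n L, N ≤ n → 2 * L < n →
    2 * (2 * Nat.size (2 * L + 2 + c)) + 1 + L + M ≤ n := by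
  refine ⟨2000 + 20 * c + 20 * M, fun n L hn hL => ?_⟩
  set s := Nat.size (2 * L + 2 + c) with hs
  have h1 : 2 ^ (s - 1) ≤ 2 * L + 2 + c := by
    rw [← Nat.lt_size]; 
    have : 0 < s := Nat.size_pos.2 (by omega)
    omega
  have hpos : 0 < s := Nat.size_pos.2 (by omega)
  have h2 : 2 ^ s = 2 * 2 ^ (s - 1) := by
    rw [← pow_succ']; congr 1; omega
  have h3 := sq_le_two_pow_aux s
  have h4 : s ^ 2 ≤ 2 * n + 2 * c + 5 := by omega
  by_contra hcon
  push Not at hcon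
  have h5 : n < 8 * s + 2 + 2 * M := by omega
  have h6 : 9 * n < 80 * s + 20 := by omega
  nlinarith

/-- Oracle power of `w_n`. There is a partial computable `g`
such that for every `n` and all strings `a, b` with `|a| + |b| < n/2`, the
computation `g(n, a, b, w_n)` halts and outputs the exact value `K(a | b)`. -/
theorem oracle_power_of_w
    (O : OptimalDecompressor) (E : CanonicalEnum O.V)
    (U : UniversalPrefixDecompressor) :
    ∃ g : ℕ × BStr × BStr × BStr →. ℕ, Partrec g ∧
      ∀ n : ℕ, ∀ a b w : BStr, IsLastSimple O E n w →
        2 * (a.length + b.length) < n →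
        K U a b ∈ g (n, a, b, w) := by
  obtain ⟨S, hS, hmono, hspec⟩ := exists_stage U.D U.partrec
  obtain ⟨c, hc⟩ := K_le_linear U
  -- the decompressor producing late strings
  let D : BStr →. BStr := fun p =>
    (Nat.rfind (fun t => Part.some (S t (decTrip p)))).map (freshStr E.e)
  have hDp : Partrec D := by
    refine Partrec.map (Partrec.rfind ?_)
      ((freshStr_computable E.e E.computable).comp Computable.snd).to₂
    exact (hS.comp Computable.snd (decTrip_primrec.to_comp.comp Computable.fst)).partrec
  obtain ⟨M, hM⟩ := O.optimal D hDp
  obtain ⟨N, hN⟩ := size_bound c M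
  -- the value K is witnessed
  have hK : ∀ a b, ∃ t, S t (K U a b, a, b) = true := by
    intro a b
    rw [hspec]
    obtain ⟨p, hp⟩ := U.onto a b
    exact Nat.sInf_mem (s := {n | ∃ p : BStr, p.length = n ∧ a ∈ U.D p b}) ⟨_, p, rfl, hp⟩
  have hKmin : ∀ a b k, (∃ t, S t (k, a, b) = true) → K U a b ≤ k := by
    intro a b k h
    exact Nat.sInf_le ((hspec _ _ _).1 h)
  choose τ hτ using hK
  obtain ⟨T₀, hT₀⟩ : ∃ T₀, ∀ a b : BStr, a.length < N → b.length < N → τ a b ≤ T₀ := by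
    have hf : (({l : BStr | l.length < N} ×ˢ {l : BStr | l.length < N})).Finite :=
      (List.finite_length_lt Bool N).prod (List.finite_length_lt Bool N)
    obtain ⟨T, hT⟩ := (hf.image (fun q : BStr × BStr => τ q.1 q.2)).bddAbove
    exact ⟨T, fun a b ha hb => hT ⟨(a, b), ⟨ha, hb⟩, rfl⟩⟩
  -- key estimate
  have key : ∀ n a b w, IsLastSimple O E n w → 2 * (a.length + b.length) < n →
      S (T₀ + strFirst E w n) (K U a b, a, b) = true := by
    intro n a b w hw hab
    by_cases hn : n < N
    · exact hmono _ _ _ ((hT₀ a b (by omega) (by omega)).trans (Nat.le_add_right _ _)) (hτ a b)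
    · push Not at hn
      have hsz := hN n _ hn hab
      set z := Nat.size (2 * (a.length + b.length) + 2 + c) with hz
      have hlt : Nat.pair a.length (K U a b) < 2 ^ (2 * z) := by
        have h1 := Nat.pair_lt_max_add_one_sq a.length (K U a b)
        have h2 : max a.length (K U a b) + 1 ≤ 2 * (a.length + b.length) + 2 + c := by
          have := hc a b
          omega
        have h3 : 2 * (a.length + b.length) + 2 + c < 2 ^ z := Nat.lt_size_self _
        calc _ < _ := h1
          _ ≤ (2 ^ z) ^ 2 := Nat.pow_le_pow_left (h2.trans h3.le) 2
          _ = _ := by rw [← pow_mul, mul_comm]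
      obtain ⟨p, hpl, hpd⟩ := exists_decTrip (2 * z) (K U a b) a b hlt
      obtain ⟨t, ht, -⟩ := Nat.rfind_min' (p := fun t => S t (decTrip p)) (m := τ a b)
        (by rw [hpd]; exact hτ a b)
      have hSt : S t (K U a b, a, b) = true := by
        have := Nat.rfind_spec ht
        rw [hpd] at this
        simpa using this
      have hx : freshStr E.e t ∈ D p := Part.mem_map _ ht
      have hCx : plainC O.V (freshStr E.e t) ≤ n := by
        have h1 := hM _ ⟨p, hx⟩
        have h2 : plainC D (freshStr E.e t) ≤ p.length := Nat.sInf_le ⟨p, rfl, hx⟩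
        omega
      have hle := hw.2 _ hCx
      have hge : t ≤ strFirst E (freshStr E.e t) n := by
        have hmem : strFirst E (freshStr E.e t) n ∈
            {s | ∃ k ≤ n, E.e s = some (freshStr E.e t, k)} := by
          apply Nat.sInf_mem
          obtain ⟨s, hs⟩ := (E.mem_iff _ _).2 hCx
          exact ⟨s, n, le_rfl, hs⟩
        obtain ⟨k, -, hk⟩ := hmem
        by_contra hcon
        push Not at hcon
        exact lt_irrefl _ (freshStr_length E.e _ _ _ _ hcon hk)
      exact hmono _ _ _ (by omega) hSt
  -- the algorithm
  let Q : ℕ × BStr × BStr × BStr → ℕ → Bool := fun q t =>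
    ((E.e t).map (fun y => decide (y.1 = q.2.2.2) && decide (y.2 ≤ q.1))).getD false
  have hQ : Computable₂ Q := by
    refine Computable.option_getD (Computable.option_map (E.computable.comp Computable.snd)
      (Primrec.to_comp ?_)) (Computable.const false)
    refine Primrec.and.comp ?_ ?_
    · exact (Primrec.eq.comp (Primrec.fst.comp Primrec.snd)
        (Primrec.snd.comp (Primrec.snd.comp (Primrec.snd.comp
          (Primrec.fst.comp Primrec.fst))))).decide
    · exact (Primrec.nat_le.comp (Primrec.snd.comp Primrec.snd)
        (Primrec.fst.comp (Primrec.fst.comp Primrec.fst))).decide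
  let g : ℕ × BStr × BStr × BStr →. ℕ := fun q =>
    (Nat.rfind (fun t => Part.some (Q q t))).bind fun t =>
      Nat.rfind (fun k => Part.some (S (T₀ + t) (k, q.2.1, q.2.2.1)))
  refine ⟨g, ?_, ?_⟩
  · refine Partrec.bind (Partrec.rfind hQ.partrec₂) ?_
    refine Partrec.rfind ?_
    have h1 : Computable (fun q : ((ℕ × BStr × BStr × BStr) × ℕ) × ℕ =>
        S (T₀ + q.1.2) (q.2, q.1.1.2.1, q.1.1.2.2.1)) := by
      refine hS.comp (Primrec.to_comp ?_) (Primrec.to_comp ?_)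
      · exact Primrec.nat_add.comp (Primrec.const T₀) (Primrec.snd.comp Primrec.fst)
      · have hq := (Primrec.snd.comp (Primrec.fst.comp (Primrec.fst (α := (ℕ × BStr × BStr × BStr) × ℕ) (β := ℕ))))
        exact Primrec.pair Primrec.snd (Primrec.pair (Primrec.fst.comp hq)
          (Primrec.fst.comp (Primrec.snd.comp hq)))
    exact h1.partrec
  · intro n a b w hw hab
    have hQiff : ∀ t, Q (n, a, b, w) t = true ↔ ∃ k ≤ n, E.e t = some (w, k) := by
      intro t
      cases h : E.e t with
      | none => simp [Q, h]
      | some y =>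
        obtain ⟨y, k⟩ := y
        simp [Q, h, and_comm]
    have hmem : strFirst E w n ∈ {s | ∃ k ≤ n, E.e s = some (w, k)} := by
      apply Nat.sInf_mem
      obtain ⟨s, hs⟩ := (E.mem_iff _ _).2 hw.1
      exact ⟨s, n, le_rfl, hs⟩
    have hfirst : strFirst E w n ∈ Nat.rfind (fun t => Part.some (Q (n, a, b, w) t)) := by
      refine Nat.mem_rfind.2 ⟨by simpa using ((hQiff _).2 hmem).symm, fun {m} hm => ?_⟩
      have : ¬ Q (n, a, b, w) m = true := by
        rw [hQiff]
        exact Nat.notMem_of_lt_sInf hm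
      simpa using this
    refine Part.mem_bind hfirst ?_
    refine Nat.mem_rfind.2 ⟨by simpa using (key n a b w hw hab).symm, fun {m} hm => ?_⟩
    have : ¬ S (T₀ + strFirst E w n) (m, a, b) = true := fun h =>
      absurd (hKmin a b m ⟨_, h⟩) (by omega)
    simpa using this
end
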